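/- arXiv:2004.08954 — 2 statements merged into one kernel-verified Lean document; each statement's English description precedes it below -/
import Mathlib

section
/- For p = 5, s = 1: for every integer n ≥ 1 and every integer b with 0 ≤ b < 5(n+1) and 5 ∤ b, one has M_{5,1,n}(b) < 0. -/
open Polynomial Finset

/-- The polynomial `T_{p,s,n}(q) = ∏_{j=0}^n ∏_{k=1}^{p-1} (1 - q^{pj+k})^s`. -/
noncomputable def borweinPoly (p s n : ℕ) : Polynomial ℤ :=
  ∏ j ∈ Finset.range (n + 1), ∏ k ∈ Finset.Icc 1 (p - 1),
    (1 - Polynomial.X ^ (p * j + k)) ^ s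

/-- The coefficient `t_{i,p,s}` of `q^i` in `T_{p,s,n}(q)`. -/
noncomputable def borweinCoeff (p s n i : ℕ) : ℤ := (borweinPoly p s n).coeff i

/-- The degree `d_{p,s,n} = p(p-1)s(n+1)^2/2` of `T_{p,s,n}`. -/
def borweinDeg (p s n : ℕ) : ℕ := p * (p - 1) * s * (n + 1) ^ 2 / 2

/-- `M_{p,s,n}(b) = ∑_{ℓ ≥ 0} t_{b + ℓ·p(n+1), p, s}`, a finite sum since the
coefficients vanish beyond the degree `d_{p,s,n}`. -/
noncomputable def borweinM (p s n b : ℕ) : ℤ :=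
  ∑ l ∈ Finset.range (borweinDeg p s n + 1), borweinCoeff p s n (b + l * (p * (n + 1)))

theorem prod_range_mul_of_periodic {M : Type*} [CommMonoid M] (f : ℕ → M) (e g : ℕ)
    (hf : ∀ j, f (j + e) = f j) :
    ∏ j ∈ range (e * g), f j = (∏ j ∈ range e, f j) ^ g := by
  have hper : ∀ g j, f (e * g + j) = f j := by
    intro g
    induction g with
    | zero => simp
    | succ g ih =>
      intro j
      rw [← ih j, ← hf (e * g + j)]
      congr 1
      ring
  induction g with
  | zero => simp
  | succ g ih =>
    rw [Nat.mul_succ, prod_range_add, ih, pow_succ]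
    simp_rw [hper]

theorem IsPrimitiveRoot.prod_range_one_sub_pow_mul {R : Type*} [CommRing R] [IsDomain R] {w : R}
    {e : ℕ} (hw : IsPrimitiveRoot w e) (he : 0 < e) (y : R) :
    ∏ j ∈ range e, (1 - w ^ j * y) = 1 - y ^ e := by
  have h := congrArg (Polynomial.eval 1) (X_pow_sub_C_eq_prod hw he (α := y) rfl)
  simpa [Polynomial.eval_prod] using h.symm

theorem IsPrimitiveRoot.borwein_prod_eq {z : ℂ} {e : ℕ} (he : 0 < e)
    (hz : IsPrimitiveRoot z (5 * e)) (g : ℕ) :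
    ∏ j ∈ range (e * g), ∏ k ∈ Icc 1 4, (1 - z ^ (5 * j + k)) = 5 ^ g := by
  rw [prod_range_mul_of_periodic]
  · congr 1
    rw [prod_comm]
    have hw : IsPrimitiveRoot (z ^ 5) e := hz.pow (by omega) rfl
    have hu : IsPrimitiveRoot (z ^ e) (4 + 1) := hz.pow (by omega) (mul_comm 5 e)
    have h := hu.prod_one_sub_pow_eq_order
    rw [range_eq_Ico, prod_Ico_add' (fun k => 1 - (z ^ e) ^ k)] at h
    have hI : Icc 1 4 = Ico (0 + 1) (4 + 1) := rfl
    have h5 : ((4 : ℕ) : ℂ) + 1 = 5 := by norm_num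
    rw [hI, ← h5, ← h]
    refine prod_congr rfl fun k _ => ?_
    rw [← pow_mul, mul_comm e k, pow_mul, ← hw.prod_range_one_sub_pow_mul he]
    exact prod_congr rfl fun j _ => by rw [pow_add, pow_mul]
  · intro j
    refine prod_congr rfl fun k _ => ?_
    rw [show 5 * (j + e) + k = 5 * j + k + 5 * e by ring, pow_add _ _ (5 * e), hz.pow_eq_one,
      mul_one]

theorem borwein_prod_eq_zero {z : ℂ} {m : ℕ} (hm : 0 < m) (hz : z ^ (5 * m) = 1)
    (hd : ¬ 5 ∣ orderOf z) :
    ∏ j ∈ range m, ∏ k ∈ Icc 1 4, (1 - z ^ (5 * j + k)) = 0 := by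
  have hle : orderOf z ≤ 5 * m := Nat.le_of_dvd (by omega) (orderOf_dvd_of_pow_eq_one hz)
  refine prod_eq_zero (i := orderOf z / 5) (mem_range.2 (by omega)) ?_
  refine prod_eq_zero (i := orderOf z % 5) (mem_Icc.2 (by omega)) ?_
  rw [Nat.div_add_mod, pow_orderOf_eq_one, sub_self]

theorem norm_borwein_prod_le {z : ℂ} {m : ℕ} (hm : 0 < m) (hz : z ^ (5 * m) = 1)
    (hz5 : z ^ 5 ≠ 1) :
    ‖∏ j ∈ range m, ∏ k ∈ Icc 1 4, (1 - z ^ (5 * j + k))‖ ≤ 5 ^ (m / 2) := by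
  by_cases hd : 5 ∣ orderOf z
  · obtain ⟨e, he⟩ := hd
    have hdvd : 5 * e ∣ 5 * m := he ▸ orderOf_dvd_of_pow_eq_one hz
    obtain ⟨g, rfl⟩ := Nat.dvd_of_mul_dvd_mul_left (by norm_num) hdvd
    have hprim : IsPrimitiveRoot z (5 * e) := he ▸ IsPrimitiveRoot.orderOf z
    have he0 : 0 < e := Nat.pos_of_mul_pos_right hm
    have he1 : e ≠ 1 := by
      rintro rfl
      exact hz5 hprim.pow_eq_one
    rw [hprim.borwein_prod_eq he0, norm_pow, Complex.norm_ofNat]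
    refine pow_le_pow_right₀ (by norm_num) ?_
    have : 2 * g ≤ e * g := Nat.mul_le_mul_right g (by omega)
    omega
  · rw [borwein_prod_eq_zero hm hz hd, norm_zero]
    positivity

theorem IsPrimitiveRoot.sum_pow_mul {R : Type*} [CommRing R] [IsDomain R] {w : R} {N : ℕ}
    (hw : IsPrimitiveRoot w N) (i : ℕ) :
    ∑ k ∈ range N, w ^ (k * i) = if N ∣ i then (N : R) else 0 := by
  simp_rw [mul_comm _ i, pow_mul]
  split_ifs with h
  · simp [(hw.pow_eq_one_iff_dvd i).2 h]
  · have h1 : w ^ i ≠ 1 := fun h' => h ((hw.pow_eq_one_iff_dvd i).1 h')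
    have h2 := mul_neg_geom_sum (w ^ i) N
    rw [← pow_mul, mul_comm i N, pow_mul, hw.pow_eq_one, one_pow, sub_self] at h2
    exact (mul_eq_zero.1 h2).resolve_left (sub_ne_zero.2 h1.symm)

theorem sum_range_mul_ite_dvd {R : Type*} [CommRing R] (a : ℕ → R) {N b : ℕ} (hb : b < N) (L : ℕ) :
    ∑ i ∈ range (N * L), a i * (if N ∣ i + (N - b) then (N : R) else 0) =
      N * ∑ l ∈ range L, a (b + l * N) := by
  induction L with
  | zero => simp
  | succ L ih =>
    rw [Nat.mul_succ, sum_range_add, ih, sum_range_succ, mul_add]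
    congr 1
    rw [sum_eq_single b]
    · rw [if_pos ⟨L + 1, by rw [mul_add, mul_one]; omega⟩, mul_comm (N : R), mul_comm N L,
        add_comm b]
    · intro r hr hrb
      rw [mem_range] at hr
      rw [if_neg, mul_zero]
      rw [add_assoc, Nat.dvd_add_right (dvd_mul_right N L)]
      rintro ⟨c, hc⟩
      have h0 : 0 < c := by
        rcases Nat.eq_zero_or_pos c with rfl | h
        · omega
        · exact h
      have h2 : c < 2 := by
        by_contra h
        have := Nat.mul_le_mul_left N (show 2 ≤ c by omega)
        omega
      obtain rfl : c = 1 := by omega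
      omega
    · intro h
      exact absurd (mem_range.2 hb) h

theorem IsPrimitiveRoot.sum_pow_mul_aeval {w : ℂ} {N b : ℕ} (hw : IsPrimitiveRoot w N) (hb : b < N)
    (P : ℤ[X]) (L : ℕ) (hP : P.natDegree < N * L) :
    ∑ k ∈ range N, w ^ (k * (N - b)) * aeval (w ^ k) P =
      (N : ℂ) * ∑ l ∈ range L, (P.coeff (b + l * N) : ℂ) := by
  rw [← sum_range_mul_ite_dvd (fun i => (P.coeff i : ℂ)) hb]
  simp_rw [aeval_eq_sum_range' hP, mul_sum]
  rw [sum_comm]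
  refine sum_congr rfl fun i _ => ?_
  rw [← hw.sum_pow_mul, mul_sum]
  refine sum_congr rfl fun k _ => ?_
  rw [zsmul_eq_mul, mul_add, pow_add, pow_mul w k i]
  ring

theorem aeval_borweinPoly (z : ℂ) (n : ℕ) :
    aeval z (borweinPoly 5 1 n) =
      ∏ j ∈ range (n + 1), ∏ k ∈ Icc 1 4, (1 - z ^ (5 * j + k)) := by
  simp [borweinPoly]

theorem natDegree_borweinPoly_lt (n : ℕ) :
    (borweinPoly 5 1 n).natDegree < 5 * (n + 1) * (borweinDeg 5 1 n + 1) := by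
  have h : (borweinPoly 5 1 n).natDegree ≤
      ∑ _j ∈ range (n + 1), ∑ _k ∈ Icc 1 (5 - 1), 5 * (n + 1) := by
    refine (natDegree_prod_le _ _).trans (sum_le_sum fun j hj => ?_)
    refine (natDegree_prod_le _ _).trans (sum_le_sum fun k hk => ?_)
    rw [mem_range] at hj
    rw [mem_Icc] at hk
    rw [pow_one]
    refine (natDegree_sub_le _ _).trans ?_
    simp only [natDegree_one, natDegree_X_pow]
    omega
  have hdeg : borweinDeg 5 1 n = 10 * (n + 1) ^ 2 := by
    unfold borweinDeg
    omega
  refine h.trans_lt ?_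
  rw [hdeg]
  simp only [sum_const, card_range, Nat.card_Icc, smul_eq_mul]
  nlinarith

theorem filter_dvd_range_five_mul {m : ℕ} (hm : 0 < m) :
    {k ∈ range (5 * m) | m ∣ k} = (range 5).image (m * ·) := by
  ext k
  simp only [mem_filter, mem_range, mem_image]
  constructor
  · rintro ⟨hk, a, rfl⟩
    exact ⟨a, by nlinarith, rfl⟩
  · rintro ⟨a, ha, rfl⟩
    exact ⟨by nlinarith, dvd_mul_right m a⟩

theorem sum_filter_dvd_borwein_prod {w : ℂ} {m c : ℕ} (hm : 0 < m)
    (hw : IsPrimitiveRoot w (5 * m)) (hc : ¬ 5 ∣ c) :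
    ∑ k ∈ range (5 * m) with m ∣ k,
      w ^ (k * c) * ∏ j ∈ range m, ∏ i ∈ Icc 1 4, (1 - (w ^ k) ^ (5 * j + i)) = -5 ^ m := by
  have hz : IsPrimitiveRoot (w ^ m) 5 := hw.pow (by omega) (mul_comm 5 m)
  rw [filter_dvd_range_five_mul hm, sum_image fun a _ b _ h => Nat.eq_of_mul_eq_mul_left hm h]
  have hsum := hz.sum_pow_mul c
  rw [if_neg hc, sum_range_succ', zero_mul, pow_zero] at hsum
  rw [sum_range_succ', mul_zero, pow_zero, borwein_prod_eq_zero hm (one_pow _) (by simp),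
    mul_zero, add_zero]
  have hterm : ∀ a ∈ range 4, w ^ (m * (a + 1) * c) *
      ∏ j ∈ range m, ∏ i ∈ Icc 1 4, (1 - (w ^ (m * (a + 1))) ^ (5 * j + i)) =
      (w ^ m) ^ ((a + 1) * c) * 5 ^ m := by
    intro a ha
    rw [mem_range] at ha
    have hcop : (a + 1).Coprime 5 := by
      interval_cases a <;> norm_num
    have hprim : IsPrimitiveRoot (w ^ (m * (a + 1))) (5 * 1) := by
      rw [pow_mul]
      exact hz.pow_of_coprime _ hcop
    have h := hprim.borwein_prod_eq one_pos m
    rw [one_mul] at h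
    rw [h, ← pow_mul, mul_assoc]
  rw [sum_congr rfl hterm, ← sum_mul, eq_neg_of_add_eq_zero_left hsum, neg_one_mul]

theorem five_mul_mul_pow_half_lt {m : ℕ} (hm : 3 ≤ m) : (5 * m - 5) * 5 ^ (m / 2) < 5 ^ m := by
  have h : ∀ r, 5 * (2 * r + 4) - 5 < 5 ^ (r + 2) := by
    intro r
    induction r with
    | zero => norm_num
    | succ r ih =>
      rw [show r + 1 + 2 = r + 2 + 1 by ring, pow_succ]
      omega
  have hhalf : 5 * m - 5 < 5 ^ (m - m / 2) := by
    have := h (m - m / 2 - 2)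
    rw [show m - m / 2 - 2 + 2 = m - m / 2 by omega] at this
    omega
  calc (5 * m - 5) * 5 ^ (m / 2) < 5 ^ (m - m / 2) * 5 ^ (m / 2) :=
        Nat.mul_lt_mul_of_pos_right hhalf (by positivity)
    _ = 5 ^ m := by rw [← pow_add]; congr 1; omega

theorem card_filter_not_dvd {m : ℕ} (hm : 0 < m) :
    #{k ∈ range (5 * m) | ¬ m ∣ k} = 5 * m - 5 := by
  have h := card_filter_add_card_filter_not (s := range (5 * m)) (fun k => m ∣ k)
  rw [filter_dvd_range_five_mul hm, card_image_of_injective _ fun a b h => Nat.eq_of_mul_eq_mul_left hm h,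
    card_range, card_range] at h
  omega

theorem norm_sum_filter_not_dvd_borwein_prod_lt {w : ℂ} {m : ℕ} (hm : 2 ≤ m)
    (hw : IsPrimitiveRoot w (5 * m)) (c : ℕ) :
    ‖∑ k ∈ range (5 * m) with ¬ m ∣ k,
      w ^ (k * c) * ∏ j ∈ range m, ∏ i ∈ Icc 1 4, (1 - (w ^ k) ^ (5 * j + i))‖ < 5 ^ m := by
  have hw1 : ‖w‖ = 1 := hw.norm'_eq_one (by omega)
  set S := {k ∈ range (5 * m) | ¬ m ∣ k} with hS
  set F : ℕ → ℂ := fun k =>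
    w ^ (k * c) * ∏ j ∈ range m, ∏ i ∈ Icc 1 4, (1 - (w ^ k) ^ (5 * j + i)) with hF
  have hcard : #S = 5 * m - 5 := card_filter_not_dvd (by omega)
  have hle : ∀ k ∈ S, ‖F k‖ ≤ 5 ^ (m / 2) := by
    intro k hk
    rw [hS, mem_filter] at hk
    rw [hF, norm_mul, norm_pow, hw1, one_pow, one_mul]
    refine norm_borwein_prod_le (by omega) ?_ ?_
    · rw [← pow_mul, mul_comm, pow_mul, hw.pow_eq_one, one_pow]
    · rw [← pow_mul, Ne, hw.pow_eq_one_iff_dvd, mul_comm k 5]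
      exact fun h => hk.2 (Nat.dvd_of_mul_dvd_mul_left (by norm_num) h)
  change ‖∑ k ∈ S, F k‖ < 5 ^ m
  rcases hm.eq_or_lt with rfl | hm3
  · have h5 : 5 ∈ S := by rw [hS]; decide
    have hF5 : F 5 = 0 := by
      have hprim : IsPrimitiveRoot (w ^ 5) 2 := hw.pow (by norm_num) rfl
      rw [hF]
      dsimp only
      rw [borwein_prod_eq_zero (by norm_num), mul_zero]
      · rw [← pow_mul, mul_comm, pow_mul, hw.pow_eq_one, one_pow]
      · rw [← hprim.eq_orderOf]
        norm_num
    rw [← add_sum_erase _ _ h5, hF5, zero_add]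
    refine (norm_sum_le_of_le _ fun k hk => hle k (mem_of_mem_erase hk)).trans_lt ?_
    rw [sum_const, card_erase_of_mem h5, hcard]
    norm_num
  · refine (norm_sum_le_of_le _ hle).trans_lt ?_
    rw [sum_const, hcard, nsmul_eq_mul]
    exact_mod_cast five_mul_mul_pow_half_lt hm3

theorem stmt_7 (n b : ℕ) (hn : 1 ≤ n) (hb : b < 5 * (n + 1)) (hdvd : ¬ 5 ∣ b) :
    borweinM 5 1 n b < 0 := by
  set N := 5 * (n + 1) with hN
  have hw : IsPrimitiveRoot (Complex.exp (2 * Real.pi * Complex.I / (N : ℕ))) N :=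
    Complex.isPrimitiveRoot_exp N (by omega)
  set w := Complex.exp (2 * Real.pi * Complex.I / (N : ℕ))
  have hsum := hw.sum_pow_mul_aeval hb _ _ (natDegree_borweinPoly_lt n)
  have hM : ∑ l ∈ range (borweinDeg 5 1 n + 1), ((borweinPoly 5 1 n).coeff (b + l * N) : ℂ) =
      ((borweinM 5 1 n b : ℤ) : ℂ) := by
    simp [borweinM, borweinCoeff, hN]
  simp_rw [aeval_borweinPoly] at hsum
  rw [hM, ← sum_filter_add_sum_filter_not _ (fun k => n + 1 ∣ k),
    sum_filter_dvd_borwein_prod n.succ_pos hw (by omega)] at hsum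
  have hlt := norm_sum_filter_not_dvd_borwein_prod_lt (m := n + 1) (by omega) hw (N - b)
  rw [← hN, eq_sub_of_add_eq' hsum, sub_neg_eq_add] at hlt
  have hlt' : |(N : ℤ) * borweinM 5 1 n b + 5 ^ (n + 1)| < 5 ^ (n + 1) := by
    have hcast : (N : ℂ) * ((borweinM 5 1 n b : ℤ) : ℂ) + 5 ^ (n + 1) =
        (((N : ℤ) * borweinM 5 1 n b + 5 ^ (n + 1) : ℤ) : ℂ) := by
      push_cast
      rfl
    rw [hcast, Complex.norm_intCast] at hlt
    exact_mod_cast hlt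
  have hneg : (N : ℤ) * borweinM 5 1 n b < 0 := by linarith [(abs_lt.1 hlt').2]
  exact (pos_iff_neg_of_mul_neg hneg).1 (by exact_mod_cast (show 0 < N by omega))
end

section
/- Let p ∈ {2, 3, 5, 7, 11, 13} and s ≥ 1 an integer. Then there exist a constant C > 0 and an integer N₀ such that for all n ≥ N₀, |log_p(max_i |t_{i,p,s}|) − s(n+1)| ≤ C·log n, where the maximum is over 0 ≤ i ≤ d_{p,s,n}. In other words, max_i |t_{i,p,s}| = p^{s(n+1)+O(log n)} as n → ∞. -/
open Polynomial Finset

/-- `max_i |t_{i,p,s}|`, the maximum over `0 ≤ i ≤ d_{p,s,n}` of the absolute values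
of the coefficients of `T_{p,s,n}`. -/
noncomputable def borweinMaxAbs (p s n : ℕ) : ℕ :=
  (Finset.range (borweinDeg p s n + 1)).sup fun i => (borweinCoeff p s n i).natAbs

/-- The point `exp (2 π i t)` of the unit circle. -/
noncomputable def circ (t : ℝ) : ℂ := Complex.exp (((2 * Real.pi * t : ℝ) : ℂ) * Complex.I)

lemma circ_add (s t : ℝ) : circ (s + t) = circ s * circ t := by
  rw [circ, circ, circ, ← Complex.exp_add]
  congr 1
  push_cast
  ring

lemma circ_natCast_mul (n : ℕ) (t : ℝ) : circ (n * t) = circ t ^ n := by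
  rw [circ, circ, ← Complex.exp_nat_mul]
  congr 1
  push_cast
  ring

lemma circ_intCast (n : ℤ) : circ n = 1 := by
  rw [circ, Complex.exp_eq_one_iff]
  exact ⟨n, by push_cast; ring⟩

lemma circ_zero : circ 0 = 1 := by simpa using circ_intCast 0

lemma norm_circ (t : ℝ) : ‖circ t‖ = 1 := Complex.norm_exp_ofReal_mul_I _

lemma circ_re (t : ℝ) : (circ t).re = Real.cos (2 * Real.pi * t) :=
  Complex.exp_ofReal_mul_I_re _

lemma circ_im (t : ℝ) : (circ t).im = Real.sin (2 * Real.pi * t) :=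
  Complex.exp_ofReal_mul_I_im _

lemma norm_one_sub_mul_circ_sq (r t : ℝ) :
    ‖1 - (r : ℂ) * circ t‖ ^ 2 = 1 + r ^ 2 - 2 * r * Real.cos (2 * Real.pi * t) := by
  rw [← Complex.normSq_eq_norm_sq, Complex.normSq_apply]
  simp only [Complex.sub_re, Complex.one_re, Complex.re_ofReal_mul, Complex.sub_im,
    Complex.one_im, Complex.im_ofReal_mul, circ_re, circ_im]
  nlinarith [Real.sin_sq_add_cos_sq (2 * Real.pi * t)]

lemma norm_one_sub_circ (t : ℝ) : ‖1 - circ t‖ = 2 * |Real.sin (Real.pi * t)| := by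
  have h := Complex.norm_exp_I_mul_ofReal_sub_one (2 * Real.pi * t)
  rw [norm_sub_rev, circ, mul_comm, h, Real.norm_eq_abs, abs_mul, abs_two]
  congr 3
  ring

lemma norm_one_sub_circ_le (t : ℝ) : ‖1 - circ t‖ ≤ 2 * Real.pi * |t| := by
  rw [norm_one_sub_circ]
  have h := Real.abs_sin_le_abs (x := Real.pi * t)
  rw [abs_mul, abs_of_pos Real.pi_pos] at h
  linarith

lemma norm_circ_sub_circ_le (s t : ℝ) : ‖circ s - circ t‖ ≤ 2 * Real.pi * |s - t| := by
  have h : circ s - circ t = -(circ t * (1 - circ (s - t))) := by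
    rw [mul_sub, ← circ_add]; ring_nf
  rw [h, norm_neg, norm_mul, norm_circ, one_mul]
  exact norm_one_sub_circ_le _

lemma four_mul_abs_le_norm_one_sub_circ {t : ℝ} (ht : |t| ≤ 1 / 2) :
    4 * |t| ≤ ‖1 - circ t‖ := by
  rw [norm_one_sub_circ]
  have h := Real.mul_abs_le_abs_sin (x := Real.pi * t) (by
    rw [abs_mul, abs_of_pos Real.pi_pos]; nlinarith [Real.pi_pos])
  rw [abs_mul, abs_of_pos Real.pi_pos] at h
  have : 2 / Real.pi * (Real.pi * |t|) = 2 * |t| := by field_simp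
  linarith

lemma circ_sub_round (t : ℝ) : circ (t - round t) = circ t := by
  have h := circ_add (t - round t) (round t)
  rw [circ_intCast, mul_one, sub_add_cancel] at h
  exact h.symm

lemma norm_one_sub_circ_le_exp_mul {r : ℝ} (hr : 0 ≤ r) (hr1 : r ≤ 1) (t : ℝ) :
    ‖1 - circ t‖ ≤ Real.exp (1 - r) * ‖1 - (r : ℂ) * circ t‖ := by
  have h1 := norm_one_sub_mul_circ_sq 1 t
  have h2 := norm_one_sub_mul_circ_sq r t
  rw [Complex.ofReal_one, one_mul] at h1
  have h3 : (1 + r) * ‖1 - circ t‖ ≤ 2 * ‖1 - (r : ℂ) * circ t‖ := by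
    apply le_of_sq_le_sq _ (by positivity)
    rw [mul_pow, mul_pow, h1, h2]
    nlinarith [mul_nonneg (sq_nonneg (1 - r)) (by linarith [Real.neg_one_le_cos (2 * Real.pi * t)] :
      (0 : ℝ) ≤ 1 + Real.cos (2 * Real.pi * t))]
  have h4 : 2 ≤ Real.exp (1 - r) * (1 + r) := by
    nlinarith [mul_le_mul_of_nonneg_right (Real.add_one_le_exp (1 - r)) (by linarith : 0 ≤ 1 + r)]
  nlinarith [norm_nonneg (1 - circ t), norm_nonneg (1 - (r : ℂ) * circ t), Real.exp_pos (1-r)]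

lemma isPrimitiveRoot_circ_rat (q : ℚ) : IsPrimitiveRoot (circ q) q.den := by
  convert! Complex.isPrimitiveRoot_exp_rat q using 1
  rw [circ]
  congr 1
  push_cast
  ring

lemma IsPrimitiveRoot.prod_one_sub_pow_mul {ζ : ℂ} {b : ℕ} (hb : 0 < b) (h : IsPrimitiveRoot ζ b)
    (z : ℂ) : ∏ i ∈ range b, (1 - ζ ^ i * z) = 1 - z ^ b := by
  have h1 := congrArg (Polynomial.eval 1) (X_pow_sub_C_eq_prod h hb (rfl : z ^ b = z ^ b))
  simpa [Polynomial.eval_prod] using h1.symm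

lemma IsPrimitiveRoot.prod_one_sub_pow_succ_mul {ζ : ℂ} {n : ℕ} (h : IsPrimitiveRoot ζ (n + 1))
    (z : ℂ) : ∏ k ∈ range n, (1 - ζ ^ (k + 1) * z) = ∑ i ∈ range (n + 1), z ^ i := by
  by_cases hz : z = 1
  · subst hz
    simpa using h.prod_one_sub_pow_eq_order
  · have h1 := h.prod_one_sub_pow_mul n.succ_pos z
    rw [prod_range_succ', pow_zero, one_mul, ← mul_neg_geom_sum, mul_comm] at h1
    exact mul_left_cancel₀ (sub_ne_zero.mpr (Ne.symm hz)) h1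

lemma sum_range_mul_add {M : Type*} [AddCommMonoid M] (f : ℕ → M) (c L : ℕ) :
    ∑ m ∈ range (c * L), f m = ∑ l ∈ range L, ∑ i ∈ range c, f (c * l + i) := by
  induction L with
  | zero => simp
  | succ L ih => rw [mul_add, mul_one, sum_range_add, ih, sum_range_succ]

lemma sum_range_eq_add_sum_Icc {M : Type*} [AddCommMonoid M] (f : ℕ → M) {p : ℕ} (hp : 0 < p) :
    ∑ i ∈ range p, f i = f 0 + ∑ k ∈ Icc 1 (p - 1), f k := by
  obtain ⟨m, rfl⟩ : ∃ m, p = m + 1 := ⟨p - 1, by omega⟩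
  have h : Icc 1 m = Ico 1 (m + 1) := by
    ext
    simp only [mem_Icc, mem_Ico]
    omega
  rw [sum_range_succ', add_comm, Nat.add_sub_cancel, h, sum_Ico_eq_sum_range]
  simp [add_comm]

lemma sum_sum_Icc_eq_sub (f : ℕ → ℝ) {p : ℕ} (hp : 0 < p) (c : ℕ) :
    ∑ i ∈ range c, ∑ k ∈ Icc 1 (p - 1), f (p * i + k) =
      ∑ m ∈ range (p * c), f m - ∑ i ∈ range c, f (p * i) := by
  rw [sum_range_mul_add, ← sum_sub_distrib]
  refine sum_congr rfl fun i _ => ?_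
  rw [sum_range_eq_add_sum_Icc _ hp]
  simp

/-- `log |1 - r e^{2 π i t}|`. -/
noncomputable def logNorm (r t : ℝ) : ℝ := Real.log ‖1 - (r : ℂ) * circ t‖

lemma one_sub_le_norm {r : ℝ} (hr : 0 ≤ r) (t : ℝ) : 1 - r ≤ ‖1 - (r : ℂ) * circ t‖ := by
  have h := norm_sub_norm_le (1 : ℂ) ((r : ℂ) * circ t)
  rwa [norm_one, norm_mul, norm_circ, mul_one, Complex.norm_real, Real.norm_of_nonneg hr] at h

lemma norm_one_sub_mul_circ_pos {r : ℝ} (hr : 0 ≤ r) (hr1 : r < 1) (t : ℝ) :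
    0 < ‖1 - (r : ℂ) * circ t‖ := (sub_pos.mpr hr1).trans_le (one_sub_le_norm hr t)

lemma logNorm_le_log_two {r : ℝ} (hr : 0 ≤ r) (hr1 : r < 1) (t : ℝ) :
    logNorm r t ≤ Real.log 2 := by
  refine Real.log_le_log (norm_one_sub_mul_circ_pos hr hr1 t) ?_
  have h := norm_sub_le (1 : ℂ) ((r : ℂ) * circ t)
  rw [norm_one, norm_mul, norm_circ, mul_one, Complex.norm_real, Real.norm_of_nonneg hr] at h
  linarith

lemma logNorm_sub_le {r : ℝ} (hr : 0 ≤ r) (hr1 : r < 1) (s t : ℝ) :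
    logNorm r s - logNorm r t ≤ 2 * Real.pi / (1 - r) * |s - t| := by
  have hs := norm_one_sub_mul_circ_pos hr hr1 s
  have ht := norm_one_sub_mul_circ_pos hr hr1 t
  have h1 := one_sub_le_norm hr t
  have hr' : 0 < 1 - r := sub_pos.mpr hr1
  rw [logNorm, logNorm, ← Real.log_div hs.ne' ht.ne']
  have h2 : ‖1 - (r : ℂ) * circ s‖ - ‖1 - (r : ℂ) * circ t‖ ≤ 2 * Real.pi * |s - t| := by
    refine (norm_sub_norm_le _ _).trans ?_
    have h3 : 1 - (r : ℂ) * circ s - (1 - (r : ℂ) * circ t) = -((r : ℂ) * (circ s - circ t)) := by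
      ring
    rw [h3, norm_neg, norm_mul, Complex.norm_real, Real.norm_of_nonneg hr]
    have := norm_circ_sub_circ_le s t
    nlinarith [norm_nonneg (circ s - circ t)]
  calc _ ≤ ‖1 - (r : ℂ) * circ s‖ / ‖1 - (r : ℂ) * circ t‖ - 1 :=
        Real.log_le_sub_one_of_pos (div_pos hs ht)
    _ = (‖1 - (r : ℂ) * circ s‖ - ‖1 - (r : ℂ) * circ t‖) / ‖1 - (r : ℂ) * circ t‖ := by
        field_simp
    _ ≤ (2 * Real.pi * |s - t|) / ‖1 - (r : ℂ) * circ t‖ := by gcongr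
    _ ≤ (2 * Real.pi * |s - t|) / (1 - r) := by
        have := Real.pi_pos
        gcongr
    _ = _ := by ring

lemma sum_logNorm_add_mul {r : ℝ} (hr : 0 ≤ r) (hr1 : r < 1) {α : ℝ} {b : ℕ} (hb : 0 < b)
    (hα : IsPrimitiveRoot (circ α) b) (y : ℝ) :
    ∑ i ∈ range b, logNorm r (y + i * α) = Real.log ‖1 - ((r : ℂ) * circ y) ^ b‖ := by
  simp only [logNorm]
  rw [← Real.log_prod fun i _ => (norm_one_sub_mul_circ_pos hr hr1 _).ne', ← norm_prod,
    ← hα.prod_one_sub_pow_mul hb]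
  congr 2
  refine prod_congr rfl fun i _ => ?_
  rw [circ_add, circ_natCast_mul]
  ring

lemma logNorm_pow_mul (r y : ℝ) (b : ℕ) :
    Real.log ‖1 - ((r : ℂ) * circ y) ^ b‖ = logNorm (r ^ b) (b * y) := by
  rw [logNorm, circ_natCast_mul, mul_pow, Complex.ofReal_pow]

/-- The block sum when `p` is coprime to the order of the root of unity. -/
lemma block_sum_of_coprime {r : ℝ} (hr : 0 ≤ r) (hr1 : r < 1) {α : ℝ} {b p : ℕ} (hb : 0 < b)
    (hp : 0 < p) (hα : IsPrimitiveRoot (circ α) b) (hpb : p.Coprime b) (y : ℝ) :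
    ∑ i ∈ range b, ∑ k ∈ Icc 1 (p - 1), logNorm r (y + ((p * i + k : ℕ) : ℝ) * α) =
      ((p : ℝ) - 1) * logNorm (r ^ b) (b * y) := by
  rw [sum_sum_Icc_eq_sub (fun m => logNorm r (y + (m : ℝ) * α)) hp, mul_comm p b,
    sum_range_mul_add]
  have h1 : ∀ l ∈ range p, ∑ i ∈ range b, logNorm r (y + ((b * l + i : ℕ) : ℝ) * α) =
      logNorm (r ^ b) (b * y) := by
    intro l _
    have h2 := sum_logNorm_add_mul hr hr1 hb hα (y + ((b * l : ℕ) : ℝ) * α)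
    have h3 : circ (((b * l : ℕ) : ℝ) * α) = 1 := by
      rw [circ_natCast_mul, pow_mul, hα.pow_eq_one, one_pow]
    rw [circ_add, h3, mul_one, logNorm_pow_mul] at h2
    rw [← h2]
    refine sum_congr rfl fun i _ => ?_
    push_cast
    ring_nf
  have h4 : ∑ i ∈ range b, logNorm r (y + ((p * i : ℕ) : ℝ) * α) = logNorm (r ^ b) (b * y) := by
    have h5 : IsPrimitiveRoot (circ (p * α)) b := by
      rw [circ_natCast_mul]
      exact hα.pow_of_coprime p hpb
    rw [← logNorm_pow_mul, ← sum_logNorm_add_mul hr hr1 hb h5]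
    refine sum_congr rfl fun i _ => ?_
    push_cast
    ring_nf
  rw [sum_congr rfl h1, h4, sum_const, card_range, nsmul_eq_mul]
  ring

/-- The block sum when the order of the root of unity is a multiple of `p`. -/
lemma block_sum_of_dvd {r : ℝ} (hr : 0 ≤ r) (hr1 : r < 1) {α : ℝ} {c p : ℕ} (hc : 0 < c)
    (hp : 0 < p) (hα : IsPrimitiveRoot (circ α) (p * c)) (y : ℝ) :
    ∑ i ∈ range c, ∑ k ∈ Icc 1 (p - 1), logNorm r (y + ((p * i + k : ℕ) : ℝ) * α) =
      Real.log ‖∑ i ∈ range p, (((r : ℂ) * circ y) ^ c) ^ i‖ := by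
  rw [sum_sum_Icc_eq_sub (fun m => logNorm r (y + (m : ℝ) * α)) hp,
    sum_logNorm_add_mul hr hr1 (Nat.mul_pos hp hc) hα]
  have h5 : IsPrimitiveRoot (circ (p * α)) c := by
    rw [circ_natCast_mul]
    exact hα.pow (Nat.mul_pos hp hc) rfl
  have h4 : ∑ i ∈ range c, logNorm r (y + ((p * i : ℕ) : ℝ) * α) =
      Real.log ‖1 - ((r : ℂ) * circ y) ^ c‖ := by
    rw [← sum_logNorm_add_mul hr hr1 hc h5]
    refine sum_congr rfl fun i _ => ?_
    push_cast
    ring_nf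
  have h6 : ∀ n : ℕ, n ≠ 0 → ‖((r : ℂ) * circ y) ^ n‖ < 1 := by
    intro n hn
    rw [norm_pow, norm_mul, norm_circ, mul_one, Complex.norm_real, Real.norm_of_nonneg hr]
    exact pow_lt_one₀ hr hr1 hn
  have h7 : ∀ n : ℕ, n ≠ 0 → ‖1 - ((r : ℂ) * circ y) ^ n‖ ≠ 0 := by
    intro n hn h
    rw [norm_eq_zero, sub_eq_zero] at h
    have := h6 n hn
    rw [← h, norm_one] at this
    exact lt_irrefl _ this
  rw [h4, ← Real.log_div (h7 _ (Nat.mul_pos hp hc).ne') (h7 _ hc.ne'), mul_comm p c, pow_mul,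
    ← mul_neg_geom_sum, norm_mul, mul_div_cancel_left₀ _ (h7 _ hc.ne')]

lemma logNorm_eq {r : ℝ} (t : ℝ) :
    logNorm r t = Real.log (1 + r ^ 2 - 2 * r * Real.cos (2 * Real.pi * t)) / 2 := by
  rw [← norm_one_sub_mul_circ_sq, Real.log_pow, logNorm]
  ring

lemma logNorm_neg (r t : ℝ) : logNorm r (-t) = logNorm r t := by
  rw [logNorm_eq, logNorm_eq, mul_neg, Real.cos_neg]

lemma logNorm_add_one (r t : ℝ) : logNorm r (t + 1) = logNorm r t := by
  have h : circ 1 = 1 := by simpa using circ_intCast 1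
  rw [logNorm, circ_add, h, mul_one, logNorm]

lemma continuous_logNorm {r : ℝ} (hr : 0 ≤ r) (hr1 : r < 1) : Continuous (logNorm r) := by
  have h : Continuous circ := by unfold circ; fun_prop
  unfold logNorm
  exact Continuous.log (by fun_prop) fun t => (norm_one_sub_mul_circ_pos hr hr1 t).ne'

lemma integral_logNorm_zero_one {r : ℝ} (hr : 0 ≤ r) (hr1 : r < 1) :
    ∫ t in (0 : ℝ)..1, logNorm r t = 0 := by
  have h := circleAverage_log_norm_sub_const₀ (a := (r : ℂ))
    (by rwa [Complex.norm_real, Real.norm_of_nonneg hr])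
  rw [Real.circleAverage_def, smul_eq_zero_iff_right (by positivity)] at h
  have h1 : ∀ θ : ℝ, Real.log ‖circleMap 0 1 θ - (r : ℂ)‖ = logNorm r (θ / (2 * Real.pi)) := by
    intro θ
    rw [logNorm_eq, show 2 * Real.pi * (θ / (2 * Real.pi)) = θ by field_simp]
    have h2 : ‖circleMap 0 1 θ - (r : ℂ)‖ ^ 2 = 1 + r ^ 2 - 2 * r * Real.cos θ := by
      rw [← Complex.normSq_eq_norm_sq, Complex.normSq_apply]
      simp only [circleMap, Complex.ofReal_one, one_mul, zero_add, Complex.sub_re, Complex.sub_im,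
        Complex.exp_ofReal_mul_I_re, Complex.exp_ofReal_mul_I_im, Complex.ofReal_re,
        Complex.ofReal_im]
      nlinarith [Real.sin_sq_add_cos_sq θ]
    rw [← h2, Real.log_pow]
    push_cast
    ring
  simp only [h1] at h
  rw [intervalIntegral.integral_comp_div (fun x => logNorm r x) (by positivity), zero_div,
    div_self (by positivity), smul_eq_zero_iff_right (by positivity)] at h
  exact h

lemma integral_logNorm_zero_half {r : ℝ} (hr : 0 ≤ r) (hr1 : r < 1) :
    ∫ t in (0 : ℝ)..(1 / 2), logNorm r t = 0 := by
  have hc := continuous_logNorm hr hr1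
  have h := intervalIntegral.integral_add_adjacent_intervals
    (hc.intervalIntegrable 0 (1 / 2)) (hc.intervalIntegrable (1 / 2) 1) (μ := MeasureTheory.volume)
  have h2 : ∫ t in (1 / 2 : ℝ)..1, logNorm r t = ∫ t in (0 : ℝ)..(1 / 2), logNorm r t := by
    have h3 := intervalIntegral.integral_comp_sub_left (logNorm r) (a := 0) (b := 1 / 2) 1
    rw [sub_zero, show (1 : ℝ) - 1 / 2 = 1 / 2 by norm_num] at h3
    rw [← h3]
    refine intervalIntegral.integral_congr fun t _ => ?_
    rw [sub_eq_add_neg, add_comm, logNorm_add_one, logNorm_neg]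
  rw [h2, integral_logNorm_zero_one hr hr1] at h
  linarith

lemma logNorm_le_logNorm {r : ℝ} (hr : 0 ≤ r) (hr1 : r < 1) {s t : ℝ} (hs : 0 ≤ s) (hst : s ≤ t)
    (ht : t ≤ 1 / 2) : logNorm r s ≤ logNorm r t := by
  have h1 : Real.cos (2 * Real.pi * t) ≤ Real.cos (2 * Real.pi * s) :=
    Real.cos_le_cos_of_nonneg_of_le_pi (by positivity) (by nlinarith [Real.pi_pos])
      (by nlinarith [Real.pi_pos])
  rw [logNorm_eq, logNorm_eq]
  have h2 : 0 < 1 + r ^ 2 - 2 * r * Real.cos (2 * Real.pi * s) := by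
    rw [← norm_one_sub_mul_circ_sq]
    exact pow_pos (norm_one_sub_mul_circ_pos hr hr1 s) 2
  have h3 := Real.log_le_log h2 (by nlinarith :
    _ ≤ 1 + r ^ 2 - 2 * r * Real.cos (2 * Real.pi * t))
  linarith

lemma cos_le_exp_neg_sq_div_two {y : ℝ} (h0 : 0 ≤ y) (h1 : y ≤ Real.pi / 2) :
    Real.cos y ≤ Real.exp (-(y ^ 2 / 2)) := by
  have hanti : AntitoneOn (fun y : ℝ => Real.cos y * Real.exp (y ^ 2 / 2))
      (Set.Icc 0 (Real.pi / 2)) := by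
    have hd : ∀ x : ℝ, HasDerivAt (fun y : ℝ => Real.cos y * Real.exp (y ^ 2 / 2))
        (Real.exp (x ^ 2 / 2) * (x * Real.cos x - Real.sin x)) x := by
      intro x
      have h2 : HasDerivAt (fun y : ℝ => y ^ 2 / 2) x x := by
        have := ((hasDerivAt_id x).pow 2).div_const 2
        simpa using this
      have h3 := (Real.hasDerivAt_cos x).mul h2.exp
      exact h3.congr_deriv (by ring)
    refine antitoneOn_of_deriv_nonpos (convex_Icc _ _)
      (fun x _ => (hd x).continuousAt.continuousWithinAt)
      (fun x _ => (hd x).differentiableAt.differentiableWithinAt) fun x hx => ?_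
    rw [interior_Icc] at hx
    rw [(hd x).deriv]
    have h4 := Real.le_tan hx.1.le hx.2
    have h5 : 0 < Real.cos x := Real.cos_pos_of_mem_Ioo ⟨by linarith [hx.1, Real.pi_pos], hx.2⟩
    rw [Real.tan_eq_sin_div_cos, le_div_iff₀ h5] at h4
    exact mul_nonpos_of_nonneg_of_nonpos (Real.exp_pos _).le (by linarith)
  have h6 := hanti ⟨le_rfl, by positivity⟩ ⟨h0, h1⟩ h0
  simp only [Real.cos_zero, ne_eq, OfNat.ofNat_ne_zero, not_false_eq_true, zero_pow, zero_div,
    Real.exp_zero, mul_one] at h6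
  rw [Real.exp_neg, ← one_div, le_div_iff₀ (Real.exp_pos _)]
  exact h6

lemma logNorm_half_add_le {r : ℝ} (hr : 99 / 100 ≤ r) (hr1 : r < 1) {s : ℝ} (hs : 0 ≤ s)
    (hs1 : s ≤ 1 / 2) :
    logNorm r (1 / 2 + s) ≤ Real.log 2 + 1 / 1000 - (Real.pi * s) ^ 2 / 2 := by
  have hpi := Real.pi_pos
  have hpi2 := Real.pi_lt_d2
  set y := Real.pi * s with hy
  have hy0 : 0 ≤ y := by positivity
  have hy1 : y ≤ Real.pi / 2 := by nlinarith
  have h1 := cos_le_exp_neg_sq_div_two hy0 hy1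
  have hcos : 0 ≤ Real.cos y := Real.cos_nonneg_of_mem_Icc ⟨by linarith, hy1⟩
  have h2 : Real.cos y ^ 2 ≤ Real.exp (-y ^ 2) := by
    calc Real.cos y ^ 2 ≤ Real.exp (-(y ^ 2 / 2)) ^ 2 := by gcongr
      _ = Real.exp (-y ^ 2) := by rw [← Real.exp_nat_mul]; congr 1; push_cast; ring
  have h3 : (1 : ℝ) / 13 ≤ Real.exp (-y ^ 2) := by
    have h4 : Real.exp (y ^ 2) ≤ 13 := by
      have h5 : Real.exp (y ^ 2) ≤ Real.exp (5 / 2) := Real.exp_le_exp.mpr (by nlinarith)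
      have h6 : Real.exp (5 / 2) ^ 2 ≤ 13 ^ 2 := by
        rw [← Real.exp_nat_mul, show ((2 : ℕ) : ℝ) * (5 / 2) = ((5 : ℕ) : ℝ) * 1 by norm_num,
          Real.exp_nat_mul]
        calc Real.exp 1 ^ 5 ≤ 2.7182818286 ^ 5 := by gcongr; exact Real.exp_one_lt_d9.le
          _ ≤ 13 ^ 2 := by norm_num
      exact h5.trans (le_of_sq_le_sq h6 (by norm_num))
    rw [Real.exp_neg, ← one_div]
    exact one_div_le_one_div_of_le (Real.exp_pos _) h4
  have h7 : 1 + r ^ 2 - 2 * r * Real.cos (2 * Real.pi * (1 / 2 + s)) =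
      (1 - r) ^ 2 + 4 * r * Real.cos y ^ 2 := by
    rw [show 2 * Real.pi * (1 / 2 + s) = 2 * y + Real.pi by rw [hy]; ring, Real.cos_add_pi,
      Real.cos_two_mul]
    ring
  have h8 : (1 - r) ^ 2 + 4 * r * Real.cos y ^ 2 ≤
      2 ^ 2 * (Real.exp (-y ^ 2) * Real.exp (2 / 1000)) := by
    have h9 := Real.add_one_le_exp (2 / 1000 : ℝ)
    have h10 : (1 - r) ^ 2 ≤ 1 / 10000 := by nlinarith
    have h11 : r * Real.cos y ^ 2 ≤ 1 * Real.exp (-y ^ 2) := by gcongr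
    nlinarith [mul_le_mul_of_nonneg_left h9 (Real.exp_pos (-y ^ 2)).le]
  have h12 : 0 < (1 - r) ^ 2 + 4 * r * Real.cos y ^ 2 := by
    rw [← h7, ← norm_one_sub_mul_circ_sq]
    exact pow_pos (norm_one_sub_mul_circ_pos (by linarith) hr1 _) 2
  rw [logNorm_eq, h7]
  have h13 := Real.log_le_log h12 h8
  rw [Real.log_mul (by norm_num) (by positivity), Real.log_pow,
    Real.log_mul (by positivity) (by positivity), Real.log_exp, Real.log_exp] at h13
  push_cast at h13
  linarith

lemma integral_logNorm_le_of_le_one {r : ℝ} (hr : 99 / 100 ≤ r) (hr1 : r < 1) {u : ℝ} (hu : 0 ≤ u)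
    (hu1 : u ≤ 1) : ∫ t in (0 : ℝ)..u, logNorm r t ≤ 208 / 1000 * u := by
  have hr0 : 0 ≤ r := by linarith
  have hc := continuous_logNorm hr0 hr1
  have hi := fun a b : ℝ => hc.intervalIntegrable a b (μ := MeasureTheory.volume)
  have hadd := intervalIntegral.integral_add_adjacent_intervals (hi 0 u) (hi u (1 / 2))
  rw [integral_logNorm_zero_half hr0 hr1] at hadd
  rcases le_or_gt u (1 / 2) with h | h
  · rcases le_or_gt (logNorm r u) 0 with h2 | h2
    · have : ∫ t in (0 : ℝ)..u, logNorm r t ≤ ∫ t in (0 : ℝ)..u, (0 : ℝ) :=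
        intervalIntegral.integral_mono_on hu (hi 0 u) (by simp) fun t ht =>
          (logNorm_le_logNorm hr0 hr1 ht.1 ht.2 h).trans h2
      rw [intervalIntegral.integral_zero] at this
      linarith
    · have : 0 ≤ ∫ t in u..(1 / 2), logNorm r t :=
        intervalIntegral.integral_nonneg h fun t ht =>
          h2.le.trans (logNorm_le_logNorm hr0 hr1 hu ht.1 ht.2)
      linarith
  · have h1 : ∫ t in (1 / 2 : ℝ)..u, logNorm r t =
        ∫ s in (0 : ℝ)..(u - 1 / 2), logNorm r (1 / 2 + s) := by
      rw [intervalIntegral.integral_comp_add_left (logNorm r)]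
      norm_num
    have h2 : ∫ s in (0 : ℝ)..(u - 1 / 2), logNorm r (1 / 2 + s) ≤
        ∫ s in (0 : ℝ)..(u - 1 / 2), (Real.log 2 + 1 / 1000 - Real.pi ^ 2 / 2 * s ^ 2) := by
      refine intervalIntegral.integral_mono_on (by linarith)
        ((hc.comp (by fun_prop)).intervalIntegrable _ _)
        (Continuous.intervalIntegrable (by fun_prop) _ _) fun s hs => ?_
      have := logNorm_half_add_le hr hr1 hs.1 (by linarith [hs.2])
      linarith
    have h3 : ∫ s in (0 : ℝ)..(u - 1 / 2), (Real.log 2 + 1 / 1000 - Real.pi ^ 2 / 2 * s ^ 2) =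
        (Real.log 2 + 1 / 1000) * (u - 1 / 2) - Real.pi ^ 2 / 6 * (u - 1 / 2) ^ 3 := by
      rw [intervalIntegral.integral_sub (by simp)
        (Continuous.intervalIntegrable (by fun_prop) _ _), intervalIntegral.integral_const_mul,
        intervalIntegral.integral_const, integral_pow]
      simp only [smul_eq_mul]
      norm_num
      ring
    have h4 := intervalIntegral.integral_add_adjacent_intervals (hi 0 (1 / 2)) (hi (1 / 2) u)
    rw [integral_logNorm_zero_half hr0 hr1, zero_add] at h4
    rw [← h4, h1]
    refine h2.trans (h3.le.trans ?_)
    obtain ⟨w, rfl⟩ : ∃ w, u = 1 / 2 + w := ⟨u - 1 / 2, by ring⟩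
    have hw : 0 ≤ w := by linarith
    rw [add_sub_cancel_left]
    have hl := Real.log_two_lt_d9
    have hp : 3.14 ^ 2 / 6 * w ^ 3 ≤ Real.pi ^ 2 / 6 * w ^ 3 := by
      gcongr; exact Real.pi_gt_d2.le
    nlinarith [mul_nonneg (sq_nonneg (w - 315 / 1000)) (by linarith : 0 ≤ w + 630 / 1000),
      mul_le_mul_of_nonneg_right hl.le hw]

lemma integral_logNorm_le {r : ℝ} (hr : 99 / 100 ≤ r) (hr1 : r < 1) {u : ℝ} (hu : 0 ≤ u) :
    ∫ t in (0 : ℝ)..u, logNorm r t ≤ 208 / 1000 * u := by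
  have hr0 : 0 ≤ r := by linarith
  have hper : Function.Periodic (logNorm r) 1 := logNorm_add_one r
  have hi := fun a b : ℝ =>
    (continuous_logNorm hr0 hr1).intervalIntegrable a b (μ := MeasureTheory.volume)
  have hstep : ∀ n : ℕ, ∀ f : ℝ, ∫ t in (0 : ℝ)..(f + n), logNorm r t =
      ∫ t in (0 : ℝ)..f, logNorm r t := by
    intro n f
    induction n with
    | zero => simp
    | succ n ih =>
      rw [← ih, ← intervalIntegral.integral_add_adjacent_intervals (hi 0 (f + n))
        (hi (f + n) (f + (n + 1 : ℕ))), Nat.cast_add, Nat.cast_one, ← add_assoc,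
        hper.intervalIntegral_add_eq (f + n) 0, zero_add, integral_logNorm_zero_one hr0 hr1,
        add_zero]
  have h1 := hstep ⌊u⌋₊ (u - ⌊u⌋₊)
  have h2 := Nat.floor_le hu
  have h3 := Nat.lt_floor_add_one u
  rw [sub_add_cancel] at h1
  rw [h1]
  refine (integral_logNorm_le_of_le_one hr hr1 (by linarith) (by linarith)).trans ?_
  have : (0 : ℝ) ≤ ⌊u⌋₊ := by positivity
  linarith

/-- Averages of `logNorm r` along a slow rotation are at most `0.208`, up to the step size. -/
lemma sum_logNorm_natCast_mul_le {r : ℝ} (hr : 99 / 100 ≤ r) (hr1 : r < 1) (φ : ℝ) (L : ℕ) :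
    ∑ l ∈ range L, logNorm r (l * φ) ≤
      L * (208 / 1000 + 2 * Real.pi / (1 - r) * |φ|) := by
  have hr0 : 0 ≤ r := by linarith
  have hi := fun a b : ℝ =>
    (continuous_logNorm hr0 hr1).intervalIntegrable a b (μ := MeasureTheory.volume)
  have hΛ : 0 ≤ 2 * Real.pi / (1 - r) := div_nonneg (by positivity) (by linarith)
  have hpos : ∀ φ : ℝ, 0 < φ → ∑ l ∈ range L, logNorm r (l * φ) ≤
      L * (208 / 1000 + 2 * Real.pi / (1 - r) * |φ|) := by
    intro φ hφ
    rw [abs_of_pos hφ]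
    set Λ := 2 * Real.pi / (1 - r) with hΛdef
    have h1 : ∀ l ∈ range L, φ * logNorm r (l * φ) ≤
        (∫ t in ((l : ℕ) * φ : ℝ)..((l + 1 : ℕ) * φ : ℝ), logNorm r t) + Λ * φ * φ := by
      intro l _
      have h2 : ∫ t in ((l : ℕ) * φ : ℝ)..((l + 1 : ℕ) * φ : ℝ), (logNorm r (l * φ) - Λ * φ) ≤
          ∫ t in ((l : ℕ) * φ : ℝ)..((l + 1 : ℕ) * φ : ℝ), logNorm r t := by
        refine intervalIntegral.integral_mono_on (by push_cast; nlinarith) (by simp) (hi _ _)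
          fun t ht => ?_
        have h3 := logNorm_sub_le hr0 hr1 (l * φ) t
        have h4 : |l * φ - t| ≤ φ := by
          obtain ⟨h5, h6⟩ := ht
          push_cast at h6
          rw [abs_le]
          constructor <;> linarith
        have := mul_le_mul_of_nonneg_left h4 hΛ
        linarith
      rw [intervalIntegral.integral_const, smul_eq_mul] at h2
      push_cast at h2 ⊢
      nlinarith
    have h7 := sum_le_sum h1
    rw [← mul_sum, sum_add_distrib, intervalIntegral.sum_integral_adjacent_intervals
      (a := fun l : ℕ => (l : ℝ) * φ) (fun k _ => hi _ _), sum_const, card_range, nsmul_eq_mul,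
      Nat.cast_zero, zero_mul] at h7
    have h8 := integral_logNorm_le hr hr1 (u := L * φ) (by positivity)
    refine le_of_mul_le_mul_left ?_ hφ
    nlinarith
  rcases lt_trichotomy φ 0 with h | h | h
  · have := hpos (-φ) (by linarith)
    rw [abs_neg] at this
    simpa only [mul_neg, logNorm_neg] using this
  · subst h
    have h0 : logNorm r 0 ≤ 0 := by
      rw [logNorm, circ_zero, mul_one, ← Complex.ofReal_one, ← Complex.ofReal_sub,
        Complex.norm_real, Real.norm_of_nonneg (by linarith)]
      exact Real.log_nonpos (by linarith) (by linarith)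
    simp only [mul_zero, abs_zero, add_zero, sum_const, card_range, nsmul_eq_mul]
    have : (0 : ℝ) ≤ L := by positivity
    nlinarith
  · exact hpos φ h

lemma norm_one_sub_circ_sq (t : ℝ) : ‖1 - circ t‖ ^ 2 = 2 * (1 - Real.cos (2 * Real.pi * t)) := by
  have h := norm_one_sub_mul_circ_sq 1 t
  rw [Complex.ofReal_one, one_mul] at h
  rw [h]
  ring

lemma sum_one_sub_cos_ge {N : ℕ} (hN : 4 ≤ N) {ψ τ : ℝ} (hψ : |ψ| ≤ 1 / 2) (hτ : 0 ≤ τ)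
    (hτ1 : τ ≤ 1) (h : τ ≤ N * |ψ|) :
    N * τ ^ 2 / 64 ≤ ∑ l ∈ range N, (1 - Real.cos (2 * Real.pi * (l * ψ))) := by
  have hN0 : (4 : ℝ) ≤ N := by exact_mod_cast hN
  rcases le_or_gt 1 (N * |ψ|) with h1 | h1
  · have hψ0 : 0 < |ψ| := by
      by_contra hcon
      nlinarith [abs_nonneg ψ]
    have h2 := four_mul_abs_le_norm_one_sub_circ hψ
    have h3 : ‖∑ l ∈ range N, circ (l * ψ)‖ * ‖1 - circ ψ‖ ≤ 2 := by
      simp only [circ_natCast_mul]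
      rw [← norm_mul, mul_comm, mul_neg_geom_sum]
      refine (norm_sub_le _ _).trans ?_
      rw [norm_one, norm_pow, norm_circ, one_pow]
      norm_num
    have h4 : ∑ l ∈ range N, Real.cos (2 * Real.pi * (l * ψ)) ≤
        ‖∑ l ∈ range N, circ (l * ψ)‖ := by
      refine le_trans (le_of_eq ?_) (Complex.re_le_norm _)
      rw [Complex.re_sum]
      exact sum_congr rfl fun l _ => (circ_re _).symm
    rw [sum_sub_distrib, sum_const, card_range, nsmul_eq_mul, mul_one]
    have h5 : ‖∑ l ∈ range N, circ (l * ψ)‖ * (4 * |ψ|) ≤ 2 :=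
      (mul_le_mul_of_nonneg_left h2 (norm_nonneg _)).trans h3
    have h6 : ‖∑ l ∈ range N, circ (l * ψ)‖ ≤ N / 2 := by
      by_contra! hcon
      nlinarith
    have h7 : τ ^ 2 ≤ 1 := by nlinarith
    nlinarith
  · obtain ⟨m, hm⟩ : ∃ m, m = N / 4 := ⟨_, rfl⟩
    have hm1 : (N : ℝ) ≤ 8 * m := by
      have : N ≤ 8 * m := by omega
      exact_mod_cast this
    have h2 : ∀ l ∈ Ico m (2 * m), N ^ 2 * ψ ^ 2 / 8 ≤ 1 - Real.cos (2 * Real.pi * (l * ψ)) := by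
      intro l hl
      rw [mem_Ico] at hl
      have h3 : (l : ℝ) * 2 ≤ N := by
        have : l * 2 ≤ N := by omega
        exact_mod_cast this
      have h4 : (N : ℝ) ≤ 8 * l := by
        have : N ≤ 8 * l := by omega
        exact_mod_cast this
      have h5 : |l * ψ| = l * |ψ| := by rw [abs_mul, Nat.abs_cast]
      have h6 := four_mul_abs_le_norm_one_sub_circ (t := l * ψ)
        (by rw [h5]; nlinarith [abs_nonneg ψ])
      have h7 := norm_one_sub_circ_sq (l * ψ)
      have h8 : (4 * |l * ψ|) ^ 2 ≤ ‖1 - circ (l * ψ)‖ ^ 2 := by gcongr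
      rw [mul_pow, sq_abs, h7, mul_pow] at h8
      have h9 : (N : ℝ) ^ 2 * ψ ^ 2 ≤ (8 * l) ^ 2 * ψ ^ 2 := by gcongr
      nlinarith
    have h3 := Finset.card_nsmul_le_sum _ _ _ h2
    have h4 : ∑ l ∈ Ico m (2 * m), (1 - Real.cos (2 * Real.pi * (l * ψ))) ≤
        ∑ l ∈ range N, (1 - Real.cos (2 * Real.pi * (l * ψ))) := by
      refine sum_le_sum_of_subset_of_nonneg (fun l hl => ?_)
        fun l _ _ => sub_nonneg.mpr (Real.cos_le_one _)
      rw [mem_Ico] at hl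
      rw [mem_range]
      omega
    refine le_trans ?_ (h3.trans h4)
    rw [Nat.card_Ico, nsmul_eq_mul, show 2 * m - m = m by omega]
    have h5 : τ ^ 2 ≤ N ^ 2 * ψ ^ 2 := by
      rw [← sq_abs ψ, ← mul_pow]
      gcongr
    nlinarith [sq_nonneg τ]

lemma norm_geom_sum_le {r : ℝ} (hr : 0 ≤ r) (hr1 : r ≤ 1) (t : ℝ) {p : ℕ} (hp : 2 ≤ p) :
    ‖∑ i ∈ range p, ((r : ℂ) * circ t) ^ i‖ ≤ p - (1 - Real.cos (2 * Real.pi * t)) / 4 := by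
  obtain ⟨m, rfl⟩ : ∃ m, p = m + 2 := ⟨p - 2, by omega⟩
  have hw : ‖(r : ℂ) * circ t‖ ≤ 1 := by
    rwa [norm_mul, norm_circ, mul_one, Complex.norm_real, Real.norm_of_nonneg hr]
  have hcos1 := Real.cos_le_one (2 * Real.pi * t)
  have hcos2 := Real.neg_one_le_cos (2 * Real.pi * t)
  have h1 : ‖1 + (r : ℂ) * circ t‖ ≤ 2 - (1 - Real.cos (2 * Real.pi * t)) / 4 := by
    have h2 := norm_one_sub_mul_circ_sq (-r) t
    rw [Complex.ofReal_neg, neg_mul, sub_neg_eq_add] at h2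
    refine le_of_sq_le_sq ?_ (by linarith)
    rw [h2]
    nlinarith
  rw [sum_range_succ', sum_range_succ', pow_zero, zero_add, pow_one, add_assoc]
  refine (norm_add_le _ _).trans ?_
  have h3 : ‖∑ k ∈ range m, ((r : ℂ) * circ t) ^ (k + 1 + 1)‖ ≤ m := by
    refine (norm_sum_le _ _).trans ?_
    refine (sum_le_card_nsmul _ _ 1 fun k _ => ?_).trans (by simp)
    rw [norm_pow]
    exact pow_le_one₀ (norm_nonneg _) hw
  rw [add_comm ((r : ℂ) * circ t)]
  push_cast
  linarith

lemma log_norm_geom_sum_le {r : ℝ} (hr : 0 ≤ r) (hr1 : r ≤ 1) (t : ℝ) {p : ℕ} (hp : 2 ≤ p) :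
    Real.log ‖∑ i ∈ range p, ((r : ℂ) * circ t) ^ i‖ ≤
      Real.log p - (1 - Real.cos (2 * Real.pi * t)) / (4 * p) := by
  have hp0 : (2 : ℝ) ≤ p := by exact_mod_cast hp
  have hcos1 := Real.cos_le_one (2 * Real.pi * t)
  have hcos2 := Real.neg_one_le_cos (2 * Real.pi * t)
  have h := norm_geom_sum_le hr hr1 t hp
  set X := ‖∑ i ∈ range p, ((r : ℂ) * circ t) ^ i‖
  rcases (show 0 ≤ X from norm_nonneg _).eq_or_lt with h0 | h0
  · rw [← h0, Real.log_zero]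
    have h1 : Real.log 2 ≤ Real.log p := Real.log_le_log (by norm_num) hp0
    have h2 := Real.log_two_gt_d9
    have h3 : (1 - Real.cos (2 * Real.pi * t)) / (4 * p) ≤ 1 / 4 := by
      rw [div_le_iff₀ (by positivity)]
      linarith
    linarith
  · have h1 := Real.log_le_sub_one_of_pos (div_pos h0 (by positivity : (0 : ℝ) < p))
    rw [Real.log_div h0.ne' (by positivity)] at h1
    have h2 : X / p ≤ (p - (1 - Real.cos (2 * Real.pi * t)) / 4) / p := by gcongr
    have h3 : (p - (1 - Real.cos (2 * Real.pi * t)) / 4) / p =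
        1 - (1 - Real.cos (2 * Real.pi * t)) / (4 * p) := by
      field_simp
    linarith

lemma sum_logNorm_le_blocks {r : ℝ} (hr : 0 ≤ r) (hr1 : r < 1) {p c : ℕ} (hp : 0 < p) (hc : 0 < c)
    (N : ℕ) (x α : ℝ) :
    ∑ j ∈ range N, ∑ k ∈ Icc 1 (p - 1), logNorm r (((p * j + k : ℕ) : ℝ) * x) ≤
      ∑ l ∈ range (N / c), ∑ i ∈ range c, ∑ k ∈ Icc 1 (p - 1),
          logNorm r (((p * c * l : ℕ) : ℝ) * x + ((p * i + k : ℕ) : ℝ) * α) +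
        (N * (p - 1) * (2 * Real.pi / (1 - r) * (p * (c * |x - α|))) +
          c * (p - 1) * Real.log 2) := by
  have hp1 : (1 : ℝ) ≤ p := by exact_mod_cast hp
  have hΛ : 0 ≤ 2 * Real.pi / (1 - r) := div_nonneg (by positivity) (by linarith)
  set E := 2 * Real.pi / (1 - r) * (p * (c * |x - α|)) with hE
  have hE0 : 0 ≤ E := by positivity
  have hcard : ((Icc 1 (p - 1)).card : ℝ) = p - 1 := by
    rw [Nat.card_Icc, Nat.add_sub_cancel, Nat.cast_sub hp, Nat.cast_one]
  have hsplit : N = c * (N / c) + N % c := (Nat.div_add_mod N c).symm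
  have h1 : ∀ l ∈ range (N / c), ∀ i ∈ range c, ∀ k ∈ Icc 1 (p - 1),
      logNorm r (((p * (c * l + i) + k : ℕ) : ℝ) * x) ≤
        logNorm r (((p * c * l : ℕ) : ℝ) * x + ((p * i + k : ℕ) : ℝ) * α) + E := by
    intro l _ i hi k hk
    rw [mem_range] at hi
    rw [mem_Icc] at hk
    have h2 := logNorm_sub_le hr hr1 (((p * (c * l + i) + k : ℕ) : ℝ) * x)
      (((p * c * l : ℕ) : ℝ) * x + ((p * i + k : ℕ) : ℝ) * α)
    have h3 : ((p * (c * l + i) + k : ℕ) : ℝ) * x -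
        (((p * c * l : ℕ) : ℝ) * x + ((p * i + k : ℕ) : ℝ) * α) =
        ((p * i + k : ℕ) : ℝ) * (x - α) := by
      push_cast
      ring
    rw [h3, abs_mul, Nat.abs_cast] at h2
    have h4 : ((p * i + k : ℕ) : ℝ) ≤ p * c := by
      have : p * i + k ≤ p * c := by
        calc p * i + k ≤ p * i + p := by omega
          _ = p * (i + 1) := by ring
          _ ≤ p * c := by gcongr; omega
      exact_mod_cast this
    have h5 : 2 * Real.pi / (1 - r) * (((p * i + k : ℕ) : ℝ) * |x - α|) ≤ E := by
      rw [hE, ← mul_assoc (p : ℝ)]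
      gcongr
    linarith
  have h6 : ∑ l ∈ range (N / c), ∑ i ∈ range c, ∑ k ∈ Icc 1 (p - 1),
      logNorm r (((p * (c * l + i) + k : ℕ) : ℝ) * x) ≤
      ∑ l ∈ range (N / c), ∑ i ∈ range c, ∑ k ∈ Icc 1 (p - 1),
        logNorm r (((p * c * l : ℕ) : ℝ) * x + ((p * i + k : ℕ) : ℝ) * α) + N * (p - 1) * E := by
    refine (sum_le_sum fun l hl => sum_le_sum fun i hi => sum_le_sum (h1 l hl i hi)).trans ?_
    simp only [sum_add_distrib, sum_const, nsmul_eq_mul, card_range, hcard]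
    have h7 : ((N / c : ℕ) : ℝ) * c ≤ N := by exact_mod_cast Nat.div_mul_le_self N c
    have h8 : 0 ≤ (p - 1) * E := mul_nonneg (by linarith) hE0
    nlinarith
  have h9 : ∑ i ∈ range (N % c), ∑ k ∈ Icc 1 (p - 1),
      logNorm r (((p * (c * (N / c) + i) + k : ℕ) : ℝ) * x) ≤ c * (p - 1) * Real.log 2 := by
    refine (sum_le_sum fun i _ => sum_le_sum fun k _ => logNorm_le_log_two hr hr1 _).trans ?_
    simp only [sum_const, nsmul_eq_mul, card_range, hcard]
    have h10 : ((N % c : ℕ) : ℝ) ≤ c := by exact_mod_cast (Nat.mod_lt N hc).le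
    have h11 : 0 ≤ ((p : ℝ) - 1) * Real.log 2 :=
      mul_nonneg (by linarith) (Real.log_nonneg (by norm_num))
    nlinarith
  have h12 := sum_range_add (fun j => ∑ k ∈ Icc 1 (p - 1), logNorm r (((p * j + k : ℕ) : ℝ) * x))
    (c * (N / c)) (N % c)
  rw [← hsplit, sum_range_mul_add] at h12
  rw [h12]
  linarith

lemma logNorm_add_natCast_mul_int (r t : ℝ) (m : ℤ) : logNorm r (t + m) = logNorm r t := by
  rw [logNorm, circ_add, circ_intCast, mul_one, logNorm]

lemma natCast_mul_rat_den (q : ℚ) : ((q.den : ℕ) : ℝ) * (q : ℝ) = (q.num : ℤ) := by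
  have h := q.den_mul_eq_num
  exact_mod_cast h

lemma sum_blocks_le_of_coprime {r : ℝ} (hr : 299 / 300 ≤ r) (hr1 : r < 1) {p : ℕ} (hp : 0 < p)
    (N : ℕ) (x : ℝ) (q : ℚ) (hpq : p.Coprime q.den) :
    ∑ l ∈ range (N / q.den), ∑ i ∈ range q.den, ∑ k ∈ Icc 1 (p - 1),
        logNorm r (((p * q.den * l : ℕ) : ℝ) * x + ((p * i + k : ℕ) : ℝ) * q) ≤
      (p - 1) * (N * (208 / 1000 + 2 * Real.pi / (1 - r) * (p * (q.den * |x - q|)))) := by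
  have hr0 : 0 ≤ r := by linarith
  have hr2 : 0 < 1 - r := by linarith
  have hp1 : (1 : ℝ) ≤ p := by exact_mod_cast hp
  obtain ⟨b, hb⟩ : ∃ b, b = q.den := ⟨_, rfl⟩
  have hb0 : 0 < b := hb ▸ q.den_pos
  have hq : (b : ℝ) * q = (q.num : ℤ) := by rw [hb]; exact natCast_mul_rat_den q
  have hroot : IsPrimitiveRoot (circ q) b := hb ▸ isPrimitiveRoot_circ_rat q
  rw [← hb] at hpq ⊢
  set φ : ℝ := p * b ^ 2 * (x - q) with hφ
  have h1 : ∀ l ∈ range (N / b), ∑ i ∈ range b, ∑ k ∈ Icc 1 (p - 1),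
      logNorm r (((p * b * l : ℕ) : ℝ) * x + ((p * i + k : ℕ) : ℝ) * q) =
      (p - 1) * logNorm (r ^ b) (l * φ) := by
    intro l _
    rw [block_sum_of_coprime hr0 hr1 hb0 hp hroot hpq,
      ← logNorm_add_natCast_mul_int _ (l * φ) ((p * b * l : ℕ) * q.num)]
    congr 2
    push_cast
    rw [← hq, hφ]
    ring
  rw [sum_congr rfl h1, ← mul_sum]
  refine mul_le_mul_of_nonneg_left ?_ (by linarith)
  have hNb : ((N / b : ℕ) : ℝ) * b ≤ N := by exact_mod_cast Nat.div_mul_le_self N b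
  have hL : (0 : ℝ) ≤ (N / b : ℕ) := by positivity
  have hΛ : 0 ≤ 2 * Real.pi / (1 - r) * (p * (b * |x - q|)) := by positivity
  have hrb1 : r ^ b < 1 := pow_lt_one₀ hr0 hr1 hb0.ne'
  rcases le_or_gt 4 b with h4 | h4
  · have h4' : (4 : ℝ) ≤ b := by exact_mod_cast h4
    have h2 : ∑ l ∈ range (N / b), logNorm (r ^ b) (l * φ) ≤ (N / b : ℕ) * Real.log 2 :=
      (sum_le_sum fun l _ => logNorm_le_log_two (pow_nonneg hr0 b) hrb1 _).trans (by simp)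
    have h3 := Real.log_two_lt_d9
    nlinarith [mul_nonneg (Nat.cast_nonneg N : (0 : ℝ) ≤ N) hΛ]
  · have hrb : 99 / 100 ≤ r ^ b := by
      have h5 : r ^ 3 ≤ r ^ b := pow_le_pow_of_le_one hr0 hr1.le (by omega)
      have h6 : (299 / 300 : ℝ) ^ 3 ≤ r ^ 3 := by gcongr
      norm_num at h6
      linarith
    have h7 : r ^ b ≤ r := by
      simpa using pow_le_pow_of_le_one hr0 hr1.le (show 1 ≤ b by omega)
    refine (sum_logNorm_natCast_mul_le hrb hrb1 φ (N / b)).trans ?_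
    have h8 : |φ| = b * (p * (b * |x - q|)) := by
      rw [hφ, abs_mul, abs_of_nonneg (by positivity)]
      ring
    have h9 : 2 * Real.pi / (1 - r ^ b) ≤ 2 * Real.pi / (1 - r) := by
      gcongr
    have h10 : 2 * Real.pi / (1 - r ^ b) * |φ| ≤
        b * (2 * Real.pi / (1 - r) * (p * (b * |x - q|))) := by
      rw [h8]
      calc _ ≤ 2 * Real.pi / (1 - r) * (b * (p * (b * |x - q|))) := by gcongr
        _ = _ := by ring
    have hb1 : (1 : ℝ) ≤ b := by exact_mod_cast hb0
    have h11 := mul_le_mul_of_nonneg_left h10 hL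
    have h12 := mul_le_mul_of_nonneg_right hNb hΛ
    nlinarith

lemma sum_blocks_le_of_dvd {r : ℝ} (hr : 0 ≤ r) (hr1 : r < 1) {p c : ℕ} (hp : 2 ≤ p)
    (hc : 0 < c) (N : ℕ) (x : ℝ) (q : ℚ) (hpq : q.den = p * c) :
    ∑ l ∈ range (N / c), ∑ i ∈ range c, ∑ k ∈ Icc 1 (p - 1),
        logNorm r (((p * c * l : ℕ) : ℝ) * x + ((p * i + k : ℕ) : ℝ) * q) ≤
      (N / c : ℕ) * Real.log p -
        (∑ l ∈ range (N / c), (1 - Real.cos (2 * Real.pi * (l * (p * c * c * (x - q)))))) /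
          (4 * p) := by
  have hq : ((p * c : ℕ) : ℝ) * q = (q.num : ℤ) := by rw [← hpq]; exact natCast_mul_rat_den q
  have hroot : IsPrimitiveRoot (circ q) (p * c) := hpq ▸ isPrimitiveRoot_circ_rat q
  rw [sum_div, ← nsmul_eq_mul, ← card_range (N / c), ← sum_const, card_range, ← sum_sub_distrib]
  refine sum_le_sum fun l _ => ?_
  rw [block_sum_of_dvd hr hr1 hc (by omega) hroot]
  have h1 : ((r : ℂ) * circ (((p * c * l : ℕ) : ℝ) * x)) ^ c =
      ((r ^ c : ℝ) : ℂ) * circ (l * (p * c * c * (x - q))) := by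
    rw [mul_pow, ← circ_natCast_mul, Complex.ofReal_pow]
    congr 1
    have h2 : (c : ℝ) * (((p * c * l : ℕ) : ℝ) * x) =
        l * (p * c * c * (x - q)) + (((c * l : ℕ) * q.num : ℤ) : ℝ) := by
      push_cast at hq ⊢
      rw [← hq]
      ring
    rw [h2, circ_add, circ_intCast, mul_one]
  rw [h1]
  exact log_norm_geom_sum_le (pow_nonneg hr c) (pow_le_one₀ hr hr1.le) _ hp

/-- The absolute value of `T_{p,1,N-1}` at the point `circ x`. -/
noncomputable def circProd (p N : ℕ) (x : ℝ) : ℝ :=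
  ∏ j ∈ range N, ∏ k ∈ Icc 1 (p - 1), ‖1 - circ (((p * j + k : ℕ) : ℝ) * x)‖

lemma circProd_nonneg (p N : ℕ) (x : ℝ) : 0 ≤ circProd p N x :=
  prod_nonneg fun _ _ => prod_nonneg fun _ _ => norm_nonneg _

lemma circProd_le_exp {p : ℕ} (hp : 0 < p) (N : ℕ) (x : ℝ) {r : ℝ} (hr : 0 ≤ r) (hr1 : r < 1) :
    circProd p N x ≤ Real.exp (N * (p - 1) * (1 - r) +
      ∑ j ∈ range N, ∑ k ∈ Icc 1 (p - 1), logNorm r (((p * j + k : ℕ) : ℝ) * x)) := by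
  have hcard : ((Icc 1 (p - 1)).card : ℝ) = p - 1 := by
    rw [Nat.card_Icc, Nat.add_sub_cancel, Nat.cast_sub hp, Nat.cast_one]
  have h : N * (p - 1) * (1 - r) +
      ∑ j ∈ range N, ∑ k ∈ Icc 1 (p - 1), logNorm r (((p * j + k : ℕ) : ℝ) * x) =
      ∑ j ∈ range N, ∑ k ∈ Icc 1 (p - 1), (1 - r + logNorm r (((p * j + k : ℕ) : ℝ) * x)) := by
    simp only [sum_add_distrib, sum_const, nsmul_eq_mul, card_range, hcard]
    ring
  rw [h, Real.exp_sum, circProd]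
  refine prod_le_prod (fun _ _ => prod_nonneg fun _ _ => norm_nonneg _) fun j _ => ?_
  rw [Real.exp_sum]
  refine prod_le_prod (fun _ _ => norm_nonneg _) fun k _ => ?_
  rw [Real.exp_add, logNorm, Real.exp_log (norm_one_sub_mul_circ_pos hr hr1 _)]
  exact norm_one_sub_circ_le_exp_mul hr hr1.le _

lemma one_div_le_abs_natCast_mul_rat_sub {q : ℚ} {k : ℕ} (hk : 0 < k) (hkq : k < q.den) (n : ℤ) :
    1 / (q.den : ℝ) ≤ |k * (q : ℝ) - n| := by
  have hd : (0 : ℝ) < q.den := by exact_mod_cast q.den_pos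
  rw [div_le_iff₀ hd]
  rw [← abs_of_pos hd, ← abs_mul]
  have h1 : (k * (q : ℝ) - n) * q.den = ((k * q.num - n * q.den : ℤ) : ℝ) := by
    push_cast
    rw [← natCast_mul_rat_den q]
    ring
  rw [h1]
  have h2 : (k * q.num - n * q.den : ℤ) ≠ 0 := by
    intro h0
    have h3 : (q.den : ℤ) ∣ k * q.num := ⟨n, by linarith⟩
    have h4 : IsCoprime (q.den : ℤ) q.num := by
      rw [Int.isCoprime_iff_gcd_eq_one, Int.gcd_comm]
      exact q.reduced
    have h5 := Int.natCast_dvd_natCast.mp (h4.dvd_of_dvd_mul_right h3)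
    exact absurd (Nat.le_of_dvd hk h5) (not_le.mpr hkq)
  exact_mod_cast Int.one_le_abs h2

lemma two_div_le_norm_one_sub_circ {q : ℚ} {k : ℕ} (hk : 0 < k) (hkq : k < q.den) {y : ℝ}
    (hy : |y| ≤ 1 / (2 * q.den)) : 2 / (q.den : ℝ) ≤ ‖1 - circ (k * q + y)‖ := by
  rw [← circ_sub_round]
  have h1 := four_mul_abs_le_norm_one_sub_circ (abs_sub_round (k * (q : ℝ) + y))
  set n := round (k * (q : ℝ) + y)
  have h2 := one_div_le_abs_natCast_mul_rat_sub hk hkq n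
  have h3 : |k * (q : ℝ) - n| ≤ |k * (q : ℝ) + y - n| + |y| := by
    have := abs_sub_le (k * (q : ℝ) - n) (k * (q : ℝ) - n + y) 0
    rw [sub_zero, sub_zero, sub_add_cancel_left, abs_neg,
      show k * (q : ℝ) - n + y = k * (q : ℝ) + y - n by ring] at this
    linarith
  have h4 : 2 / (q.den : ℝ) = 4 * (1 / q.den - 1 / (2 * q.den)) := by
    have : (q.den : ℝ) ≠ 0 := by exact_mod_cast q.den_ne_zero
    field_simp
    norm_num
  rw [h4]
  linarith

/-- Close to a fraction with denominator `p`, the product exceeds `p ^ N` by at most a constant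
factor. -/
lemma circProd_le_of_near {p : ℕ} (hp : 0 < p) (N : ℕ) (x : ℝ) (q : ℚ) (hq : q.den = p)
    (hx : N * |x - q| ≤ 1 / (2 * p ^ 2)) :
    circProd p N x ≤ p ^ N * Real.exp (Real.pi * p) := by
  obtain ⟨n, rfl⟩ : ∃ n, p = n + 1 := ⟨p - 1, by omega⟩
  set p := n + 1 with hpn
  have hp0 : (0 : ℝ) < p := by exact_mod_cast hp
  have hroot : IsPrimitiveRoot (circ q) (n + 1) := by
    have h := isPrimitiveRoot_circ_rat q
    rwa [hq] at h
  have hint : (p : ℝ) * q = (q.num : ℤ) := by rw [← hq]; exact natCast_mul_rat_den q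
  set θ := x - q with hθ
  set E := Real.exp (Real.pi * p ^ 2 * |θ|) with hE
  have hrow : ∀ j ∈ range N, ∏ k ∈ Icc 1 (p - 1), ‖1 - circ (((p * j + k : ℕ) : ℝ) * x)‖ ≤
      p * E ^ p := by
    intro j hj
    rw [mem_range] at hj
    have hjN : (j : ℝ) ≤ N := by exact_mod_cast hj.le
    set y := p * j * θ with hy
    have hy1 : |y| ≤ 1 / (2 * q.den) := by
      rw [hy, hq, abs_mul, abs_of_nonneg (by positivity)]
      have : (j : ℝ) * |θ| ≤ 1 / (2 * p ^ 2) :=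
        (mul_le_mul_of_nonneg_right hjN (abs_nonneg _)).trans hx
      calc p * j * |θ| = p * (j * |θ|) := by ring
        _ ≤ p * (1 / (2 * p ^ 2)) := by gcongr
        _ = 1 / (2 * p) := by field_simp
    have hfac : ∀ k ∈ Icc 1 (p - 1), ‖1 - circ (((p * j + k : ℕ) : ℝ) * x)‖ ≤
        ‖1 - circ (k * q + y)‖ * E := by
      intro k hk
      rw [mem_Icc] at hk
      have h1 := two_div_le_norm_one_sub_circ (q := q) (k := k) (by omega) (by omega) hy1
      rw [hq] at h1
      have h2 : circ (((p * j + k : ℕ) : ℝ) * x) = circ (k * q + y + k * θ) := by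
        have : ((p * j + k : ℕ) : ℝ) * x = k * q + y + k * θ + ((j * q.num : ℤ) : ℝ) := by
          push_cast
          rw [← hint, hy, hθ]
          ring
        rw [this, circ_add, circ_intCast, mul_one]
      have h3 := norm_circ_sub_circ_le (k * q + y) (k * q + y + k * θ)
      rw [sub_add_cancel_left, abs_neg, abs_mul, Nat.abs_cast] at h3
      have hkp : (k : ℝ) ≤ p := by
        have : k ≤ p := by omega
        exact_mod_cast this
      have h4 : ‖1 - circ (k * q + y + k * θ)‖ ≤
          ‖1 - circ (k * q + y)‖ + 2 * Real.pi * (p * |θ|) := by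
        calc _ = ‖(1 - circ (k * q + y)) + (circ (k * q + y) - circ (k * q + y + k * θ))‖ := by
              congr 1; ring
          _ ≤ ‖1 - circ (k * q + y)‖ + ‖circ (k * q + y) - circ (k * q + y + k * θ)‖ :=
              norm_add_le _ _
          _ ≤ ‖1 - circ (k * q + y)‖ + 2 * Real.pi * (k * |θ|) := by gcongr
          _ ≤ _ := by gcongr
      have h5 : 2 * Real.pi * (p * |θ|) ≤ ‖1 - circ (k * q + y)‖ * (Real.pi * p ^ 2 * |θ|) := by
        calc 2 * Real.pi * (p * |θ|) = 2 / p * (Real.pi * p ^ 2 * |θ|) := by field_simp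
          _ ≤ _ := by gcongr
      have h6 := Real.add_one_le_exp (Real.pi * p ^ 2 * |θ|)
      rw [h2]
      nlinarith [norm_nonneg (1 - circ (k * q + y))]
    have h7 : ∏ k ∈ Icc 1 (p - 1), ‖1 - circ (k * q + y)‖ ≤ p := by
      have h8 : ∏ k ∈ Icc 1 (p - 1), (1 - circ (k * q + y)) = ∑ i ∈ range (n + 1), circ y ^ i := by
        rw [← hroot.prod_one_sub_pow_succ_mul]
        have h : Icc 1 (p - 1) = Ico 1 (n + 1) := by
          ext
          simp only [mem_Icc, mem_Ico]
          omega
        rw [h, prod_Ico_eq_prod_range]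
        refine prod_congr (by simp) fun k _ => ?_
        rw [circ_add, circ_natCast_mul, add_comm 1 k]
      rw [← norm_prod, h8]
      refine (norm_sum_le _ _).trans ?_
      simp only [norm_pow, norm_circ, one_pow, sum_const, card_range, nsmul_eq_mul, mul_one]
      rfl
    calc _ ≤ ∏ k ∈ Icc 1 (p - 1), (‖1 - circ (k * q + y)‖ * E) :=
          prod_le_prod (fun _ _ => norm_nonneg _) hfac
      _ = (∏ k ∈ Icc 1 (p - 1), ‖1 - circ (k * q + y)‖) * E ^ (p - 1) := by
          rw [prod_mul_distrib, prod_const, Nat.card_Icc, Nat.add_sub_cancel (p - 1) 1]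
      _ ≤ p * E ^ p := by
          have hE1 : 1 ≤ E := Real.one_le_exp (by positivity)
          exact mul_le_mul h7 (pow_le_pow_right₀ hE1 (by omega)) (by positivity) (by positivity)
  calc circProd p N x ≤ ∏ _j ∈ range N, (p * E ^ p) :=
        prod_le_prod (fun _ _ => prod_nonneg fun _ _ => norm_nonneg _) hrow
    _ = p ^ N * Real.exp (Real.pi * p * (p ^ 2 * (N * |θ|))) := by
        rw [prod_const, card_range, mul_pow, hE, ← Real.exp_nat_mul, ← Real.exp_nat_mul]
        congr 2
        ring
    _ ≤ p ^ N * Real.exp (Real.pi * p) := by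
        have h9 : (p : ℝ) ^ 2 * (N * |θ|) ≤ 1 := by
          calc (p : ℝ) ^ 2 * (N * |θ|) ≤ p ^ 2 * (1 / (2 * p ^ 2)) := by gcongr
            _ ≤ 1 := by field_simp; norm_num
        refine mul_le_mul_of_nonneg_left (Real.exp_le_exp.mpr ?_) (by positivity)
        have : Real.pi * p * (p ^ 2 * (N * |θ|)) ≤ Real.pi * p * 1 := by gcongr
        linarith

lemma sum_logNorm_le_or_near {p : ℕ} (hp : p.Prime)
    (hlog : ((p : ℝ) - 1) * (2125 / 10000) ≤ Real.log p)
    {r : ℝ} (hr : 299 / 300 ≤ r) (hr1 : r < 1) {N Q : ℕ} (hN : 4 ≤ N) (hQ : 0 < Q) (x : ℝ) :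
    (∃ q : ℚ, q.den = p ∧ N * |x - q| ≤ 1 / (2 * p ^ 2)) ∨
    ∑ j ∈ range N, ∑ k ∈ Icc 1 (p - 1), logNorm r (((p * j + k : ℕ) : ℝ) * x) ≤
      N * (Real.log p - 1 / (4096 * p ^ 3)) +
        2 * (N * (p - 1) * (2 * Real.pi / (1 - r) * (p * (1 / (Q + 1))))) +
        Q * (p - 1) * Real.log 2 := by
  have hr0 : 0 ≤ r := by linarith
  have hr2 : 0 < 1 - r := by linarith
  have hp2 : (2 : ℝ) ≤ p := by exact_mod_cast hp.two_le
  have hN0 : (0 : ℝ) ≤ N := by positivity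
  obtain ⟨q, hq1, hq2⟩ := Real.exists_rat_abs_sub_le_and_den_le x hQ
  have hd : (0 : ℝ) < q.den := by exact_mod_cast q.den_pos
  have hq3 : (q.den : ℝ) * |x - q| ≤ 1 / (Q + 1) := by
    calc (q.den : ℝ) * |x - q| ≤ q.den * (1 / ((Q + 1) * q.den)) := by gcongr
      _ = 1 / (Q + 1) := by field_simp
  set D : ℝ := 2 * Real.pi / (1 - r) * (p * (1 / (Q + 1))) with hD
  have hD0 : 0 ≤ D := by positivity
  have hND : 0 ≤ N * ((p : ℝ) - 1) * D :=
    mul_nonneg (mul_nonneg hN0 (by linarith)) hD0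
  have hsmall : 1 / (4096 * (p : ℝ) ^ 3) ≤ 1 / 32768 := by
    apply one_div_le_one_div_of_le (by norm_num)
    have : (2 : ℝ) ^ 3 ≤ (p : ℝ) ^ 3 := by gcongr
    linarith
  have hsmall0 : 0 ≤ 1 / (4096 * (p : ℝ) ^ 3) := by positivity
  have hlog2 := Real.log_two_gt_d9
  have herr : ∀ c : ℕ, 0 < c → c ≤ q.den → ∀ M : ℝ,
      ∑ j ∈ range N, ∑ k ∈ Icc 1 (p - 1), logNorm r (((p * j + k : ℕ) : ℝ) * x) ≤
        M + (N * (p - 1) * (2 * Real.pi / (1 - r) * (p * (c * |x - q|))) +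
          c * (p - 1) * Real.log 2) →
      ∑ j ∈ range N, ∑ k ∈ Icc 1 (p - 1), logNorm r (((p * j + k : ℕ) : ℝ) * x) ≤
        M + N * (p - 1) * D + Q * (p - 1) * Real.log 2 := by
    intro c _ hcq M h
    have h1 : (c : ℝ) * |x - q| ≤ 1 / (Q + 1) := by
      refine le_trans ?_ hq3
      gcongr
    have h2 : 2 * Real.pi / (1 - r) * (p * (c * |x - q|)) ≤ D := by
      rw [hD]
      gcongr
    have h3 : N * ((p : ℝ) - 1) * (2 * Real.pi / (1 - r) * (p * (c * |x - q|))) ≤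
        N * (p - 1) * D :=
      mul_le_mul_of_nonneg_left h2 (mul_nonneg hN0 (by linarith))
    have h4 : (c : ℝ) * (p - 1) * Real.log 2 ≤ Q * (p - 1) * Real.log 2 := by
      have h5 : (c : ℝ) ≤ Q := by exact_mod_cast hcq.trans hq2
      have h6 : (0 : ℝ) ≤ p - 1 := by linarith
      gcongr
    linarith
  by_cases hpq : p ∣ q.den
  · obtain ⟨c, hc⟩ := hpq
    have hc0 : 0 < c := Nat.pos_of_ne_zero fun h => q.den_ne_zero (by rw [hc, h, mul_zero])
    have hcle : c ≤ q.den := by rw [hc]; exact Nat.le_mul_of_pos_left c hp.pos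
    have hblock := sum_blocks_le_of_dvd hr0 hr1 hp.two_le hc0 N x q hc
    have htot := herr c hc0 hcle _ ((sum_logNorm_le_blocks hr0 hr1 hp.one_le hc0 N x q).trans
      (add_le_add_left hblock _))
    rcases (show c = 1 ∨ 2 ≤ c by omega) with rfl | hc2
    · by_cases hnear : N * |x - q| ≤ 1 / (2 * p ^ 2)
      · exact Or.inl ⟨q, by omega, hnear⟩
      · right
        rw [not_le] at hnear
        have hψ : |(p : ℝ) * (1 : ℕ) * (1 : ℕ) * (x - q)| = q.den * |x - q| := by
          rw [hc]
          push_cast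
          rw [abs_mul, abs_of_nonneg (by linarith)]
          ring
        have hQ1 : (1 : ℝ) ≤ Q := by exact_mod_cast hQ
        have h1 : |(p : ℝ) * (1 : ℕ) * (1 : ℕ) * (x - q)| ≤ 1 / 2 := by
          rw [hψ]
          refine hq3.trans (one_div_le_one_div_of_le (by norm_num) (by linarith))
        have h2 : 1 / (2 * (p : ℝ)) ≤ 1 := by
          rw [div_le_one (by linarith)]
          linarith
        have h3 : 1 / (2 * (p : ℝ)) ≤ N * |(p : ℝ) * (1 : ℕ) * (1 : ℕ) * (x - q)| := by
          rw [hψ, hc]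
          push_cast
          calc 1 / (2 * (p : ℝ)) = p * (1 / (2 * p ^ 2)) := by field_simp
            _ ≤ p * (N * |x - q|) := by gcongr
            _ = _ := by ring
        have h4 := sum_one_sub_cos_ge hN h1 (by positivity) h2 h3
        rw [Nat.div_one] at htot
        have h5 : N * (1 / (2 * (p : ℝ))) ^ 2 / 64 / (4 * p) = N * (4 * (1 / (4096 * p ^ 3))) := by
          field_simp
          norm_num
        have h6 := div_le_div_of_nonneg_right h4 (show (0 : ℝ) ≤ 4 * p by linarith)
        rw [h5] at h6
        nlinarith [mul_nonneg hN0 hsmall0]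
    · right
      have h1 : ((N / c : ℕ) : ℝ) ≤ N / 2 := by
        refine Nat.cast_div_le.trans ?_
        have : (2 : ℝ) ≤ c := by exact_mod_cast hc2
        gcongr
      have h2 : Real.log 2 ≤ Real.log p := Real.log_le_log (by norm_num) hp2
      have h3 : 0 ≤ (∑ l ∈ range (N / c),
          (1 - Real.cos (2 * Real.pi * (l * (p * c * c * (x - q)))))) / (4 * p) :=
        div_nonneg (sum_nonneg fun _ _ => sub_nonneg.mpr (Real.cos_le_one _)) (by linarith)
      have h4 : ((N / c : ℕ) : ℝ) * Real.log p ≤ N / 2 * Real.log p := by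
        refine mul_le_mul_of_nonneg_right h1 ?_
        linarith
      nlinarith
  · right
    have hblock := sum_blocks_le_of_coprime hr hr1 hp.pos N x q
      ((Nat.Prime.coprime_iff_not_dvd hp).mpr hpq)
    have htot := herr q.den q.den_pos le_rfl _
      ((sum_logNorm_le_blocks hr0 hr1 hp.one_le q.den_pos N x q).trans (add_le_add_left hblock _))
    have h2 : 2 * Real.pi / (1 - r) * (p * (q.den * |x - q|)) ≤ D := by
      rw [hD]
      gcongr
    have h3 : N * ((p : ℝ) - 1) * (2 * Real.pi / (1 - r) * (p * (q.den * |x - q|))) ≤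
        N * (p - 1) * D :=
      mul_le_mul_of_nonneg_left h2 (mul_nonneg hN0 (by linarith))
    have h4 : N * (((p : ℝ) - 1) * (208 / 1000)) ≤ N * (Real.log p - 1 / (4096 * p ^ 3)) := by
      refine mul_le_mul_of_nonneg_left ?_ hN0
      linarith
    linarith

/-- The supremum of `|T_{p,1,N-1}|` on the unit circle is `O(p ^ N)`. -/
lemma exists_circProd_le {p : ℕ} (hp : p.Prime)
    (hlog : ((p : ℝ) - 1) * (2125 / 10000) ≤ Real.log p) :
    ∃ N₀ : ℕ, ∀ N : ℕ, N₀ ≤ N → ∀ x : ℝ, circProd p N x ≤ p ^ N * Real.exp (Real.pi * p) := by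
  have hp2 : (2 : ℝ) ≤ p := by exact_mod_cast hp.two_le
  obtain ⟨ε, hε⟩ : ∃ ε : ℝ, ε = 1 / (4096 * p ^ 4) := ⟨_, rfl⟩
  have hε0 : 0 < ε := by rw [hε]; positivity
  have hε1 : ε ≤ 1 / 65536 := by
    rw [hε]
    apply one_div_le_one_div_of_le (by norm_num)
    have : (2 : ℝ) ^ 4 ≤ (p : ℝ) ^ 4 := by gcongr
    linarith
  have hpε : p * ε = 1 / (4096 * p ^ 3) := by
    rw [hε]
    field_simp
  obtain ⟨r, hrε⟩ : ∃ r : ℝ, 1 - r = ε / 2 := ⟨1 - ε / 2, by ring⟩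
  obtain ⟨Q, hQ⟩ := exists_nat_ge (max 1 (2 * Real.pi / (1 - r) * p / (ε / 4)))
  have hQ1 : (1 : ℝ) ≤ Q := (le_max_left _ _).trans hQ
  have hD : 2 * Real.pi / (1 - r) * (p * (1 / ((Q : ℝ) + 1))) ≤ ε / 4 := by
    have h1 := (le_max_right _ _).trans hQ
    rw [div_le_iff₀ (by positivity)] at h1
    rw [mul_one_div, ← mul_div_assoc, div_le_iff₀ (by positivity)]
    linarith
  obtain ⟨N₁, hN₁⟩ := exists_nat_ge (Q * (p - 1) * Real.log 2 / ε)
  refine ⟨max 4 N₁, fun N hN x => ?_⟩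
  have hN4 : 4 ≤ N := (le_max_left _ _).trans hN
  have hNN : (N₁ : ℝ) ≤ N := by exact_mod_cast (le_max_right _ _).trans hN
  have hN0 : (0 : ℝ) ≤ N := by positivity
  have hr : 299 / 300 ≤ r := by linarith
  have hr1 : r < 1 := by linarith
  rcases sum_logNorm_le_or_near hp hlog hr hr1 hN4 (by exact_mod_cast hQ1) x with
    ⟨q, hq, hnear⟩ | hS
  · exact circProd_le_of_near hp.pos N x q hq hnear
  · have h1 := circProd_le_exp hp.pos N x (by linarith) hr1
    have h2 : N * ((p : ℝ) - 1) * (2 * Real.pi / (1 - r) * (p * (1 / (Q + 1)))) ≤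
        N * (p - 1) * (ε / 4) :=
      mul_le_mul_of_nonneg_left hD (mul_nonneg hN0 (by linarith))
    have h3 : (Q : ℝ) * (p - 1) * Real.log 2 ≤ N * ε := by
      rw [div_le_iff₀ hε0] at hN₁
      exact hN₁.trans (by gcongr)
    rw [← hpε] at hS
    have h4 : N * ((p : ℝ) - 1) * (1 - r) + ∑ j ∈ range N, ∑ k ∈ Icc 1 (p - 1),
        logNorm r (((p * j + k : ℕ) : ℝ) * x) ≤ N * Real.log p := by
      rw [hrε]
      linarith
    have h5 : Real.exp (N * Real.log p) = (p : ℝ) ^ N := by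
      rw [Real.exp_nat_mul, Real.exp_log (by linarith)]
    calc circProd p N x ≤ (p : ℝ) ^ N := h1.trans (h5 ▸ Real.exp_le_exp.mpr h4)
      _ ≤ _ := le_mul_of_one_le_right (by positivity) (Real.one_le_exp (by positivity))

lemma sub_one_mul_le_log {p : ℕ} (hp : p = 2 ∨ p = 3 ∨ p = 5 ∨ p = 7 ∨ p = 11 ∨ p = 13) :
    ((p : ℝ) - 1) * (2125 / 10000) ≤ Real.log p := by
  have key : ∀ m : ℕ, (27182818286 / 10000000000 : ℝ) ^ (17 * m) ≤ ((m + 1 : ℕ) : ℝ) ^ 80 →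
      (((m + 1 : ℕ) : ℝ) - 1) * (2125 / 10000) ≤ Real.log ((m + 1 : ℕ) : ℝ) := by
    intro m h
    have h1 : Real.exp (17 * m : ℕ) ≤ ((m + 1 : ℕ) : ℝ) ^ 80 := by
      refine le_trans ?_ h
      rw [← Real.exp_one_pow]
      exact pow_le_pow_left₀ (Real.exp_pos _).le
        (Real.exp_one_lt_d9.le.trans (by norm_num)) _
    have h2 := (Real.le_log_iff_exp_le (by positivity)).mpr h1
    rw [Real.log_pow] at h2
    push_cast at h2 ⊢
    linarith
  rcases hp with rfl | rfl | rfl | rfl | rfl | rfl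
  · exact key 1 (by norm_num)
  · exact key 2 (by norm_num)
  · exact key 4 (by norm_num)
  · exact key 6 (by norm_num)
  · exact key 10 (by norm_num)
  · exact key 12 (by norm_num)

lemma circProd_rat {p : ℕ} (hp : 0 < p) (N : ℕ) (q : ℚ) (hq : q.den = p) :
    circProd p N q = p ^ N := by
  obtain ⟨n, rfl⟩ : ∃ n, p = n + 1 := ⟨p - 1, by omega⟩
  have hroot : IsPrimitiveRoot (circ q) (n + 1) := by
    have h := isPrimitiveRoot_circ_rat q
    rwa [hq] at h
  have hint : ((n + 1 : ℕ) : ℝ) * q = (q.num : ℤ) := by rw [← hq]; exact natCast_mul_rat_den q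
  have hrow : ∀ j ∈ range N, ∏ k ∈ Icc 1 (n + 1 - 1),
      ‖1 - circ ((((n + 1) * j + k : ℕ) : ℝ) * q)‖ = ((n + 1 : ℕ) : ℝ) := by
    intro j _
    have h1 : ∀ k : ℕ, circ ((((n + 1) * j + k : ℕ) : ℝ) * q) = circ q ^ k := by
      intro k
      have : (((n + 1) * j + k : ℕ) : ℝ) * q = k * q + ((j * q.num : ℤ) : ℝ) := by
        push_cast at hint ⊢
        rw [← hint]
        ring
      rw [this, circ_add, circ_intCast, mul_one, circ_natCast_mul]
    simp only [h1]
    have h2 : Icc 1 (n + 1 - 1) = Ico 1 (n + 1) := by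
      ext
      simp only [mem_Icc, mem_Ico]
      omega
    rw [h2, prod_Ico_eq_prod_range, ← norm_prod]
    have h3 := hroot.prod_one_sub_pow_eq_order
    simp only [add_comm 1, Nat.add_sub_cancel]
    rw [h3, ← Nat.cast_succ, Complex.norm_natCast]
  rw [circProd, prod_congr rfl hrow, prod_const, card_range]

lemma norm_eval_borweinPoly (p s n : ℕ) (x : ℝ) :
    ‖((borweinPoly p s n).map (Int.castRingHom ℂ)).eval (circ x)‖ = circProd p (n + 1) x ^ s := by
  simp only [borweinPoly, circProd, Polynomial.map_prod, Polynomial.map_pow, Polynomial.map_sub,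
    Polynomial.map_one, Polynomial.map_X, eval_prod, eval_pow, eval_sub, eval_one, eval_X,
    norm_prod, norm_pow, ← prod_pow, circ_natCast_mul]

lemma Polynomial.norm_coeff_le_of_norm_eval_circ_le (f : ℂ[X]) {M : ℝ}
    (h : ∀ x : ℝ, ‖f.eval (circ x)‖ ≤ M) (i : ℕ) : ‖f.coeff i‖ ≤ M := by
  have hM : 0 ≤ M := (norm_nonneg _).trans (h 0)
  by_cases hi : i ∈ f.support
  · have h1 : ‖f.coeff i‖ ^ 2 ≤ ∑ j ∈ f.support, ‖f.coeff j‖ ^ 2 :=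
      single_le_sum (f := fun j => ‖f.coeff j‖ ^ 2) (fun _ _ => sq_nonneg _) hi
    rw [Polynomial.sum_sq_norm_coeff_eq_circleAverage] at h1
    have h2 : Real.circleAverage (fun θ ↦ ‖f.eval θ‖ ^ 2) 0 1 ≤ M ^ 2 := by
      refine Real.circleAverage_mono_on_of_le_circle ?_ ?_
      · apply ContinuousOn.circleIntegrable (by norm_num)
        fun_prop
      · intro z hz
        rw [abs_one, mem_sphere_zero_iff_norm] at hz
        have h3 : z = circ (Complex.arg z / (2 * Real.pi)) := by
          have h4 := Complex.norm_mul_exp_arg_mul_I z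
          rw [hz, Complex.ofReal_one, one_mul] at h4
          rw [circ]
          nth_rewrite 1 [← h4]
          congr 2
          push_cast
          field_simp
        rw [h3]
        exact pow_le_pow_left₀ (norm_nonneg _) (h _) 2
    exact abs_le_of_sq_le_sq' (h1.trans h2) hM |>.2
  · rw [notMem_support_iff.mp hi, norm_zero]
    exact hM

lemma two_mul_sum_Icc_add (c m : ℕ) : 2 * ∑ k ∈ Icc 1 m, (c + k) = m * (2 * c + m + 1) := by
  induction m with
  | zero => simp
  | succ m ih =>
    rw [sum_Icc_succ_top (by omega), mul_add, ih]
    ring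

lemma two_mul_sum_mul_add (p N : ℕ) :
    2 * ∑ j ∈ range N, ∑ k ∈ Icc 1 (p - 1), (p * j + k) = p * (p - 1) * N ^ 2 := by
  rcases p with _ | m
  · simp
  have h : ∀ j : ℕ, 2 * ∑ k ∈ Icc 1 (m + 1 - 1), ((m + 1) * j + k) = (m + 1) * m * (2 * j + 1) := by
    intro j
    rw [Nat.add_sub_cancel, two_mul_sum_Icc_add]
    ring
  induction N with
  | zero => simp
  | succ N ih =>
    rw [sum_range_succ, mul_add, ih, h, Nat.add_sub_cancel]
    ring

lemma natDegree_borweinPoly_le (p s n : ℕ) : (borweinPoly p s n).natDegree ≤ borweinDeg p s n := by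
  have h1 : (borweinPoly p s n).natDegree ≤
      s * ∑ j ∈ range (n + 1), ∑ k ∈ Icc 1 (p - 1), (p * j + k) := by
    rw [borweinPoly, mul_sum]
    refine (natDegree_prod_le _ _).trans (sum_le_sum fun j _ => ?_)
    rw [mul_sum]
    refine (natDegree_prod_le _ _).trans (sum_le_sum fun k _ => ?_)
    refine natDegree_pow_le_of_le s ?_
    refine (natDegree_sub_le _ _).trans ?_
    simp
  have h2 := two_mul_sum_mul_add p (n + 1)
  rw [borweinDeg, Nat.le_div_iff_mul_le (by norm_num)]
  calc _ ≤ (s * ∑ j ∈ range (n + 1), ∑ k ∈ Icc 1 (p - 1), (p * j + k)) * 2 := by gcongr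
    _ = s * (2 * ∑ j ∈ range (n + 1), ∑ k ∈ Icc 1 (p - 1), (p * j + k)) := by ring
    _ ≤ _ := by rw [h2]; apply le_of_eq; ring

lemma natAbs_borweinCoeff_le_borweinMaxAbs {p s n i : ℕ} (hi : i ≤ borweinDeg p s n) :
    (borweinCoeff p s n i).natAbs ≤ borweinMaxAbs p s n :=
  le_sup (f := fun i => (borweinCoeff p s n i).natAbs) (mem_range.mpr (Nat.lt_succ_of_le hi))

lemma norm_eval_borweinPoly_le (p s n : ℕ) (x : ℝ) :
    ‖((borweinPoly p s n).map (Int.castRingHom ℂ)).eval (circ x)‖ ≤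
      (borweinDeg p s n + 1) * borweinMaxAbs p s n := by
  rw [eval_eq_sum_range' (n := borweinDeg p s n + 1)
    (Nat.lt_succ_of_le (natDegree_map_le.trans (natDegree_borweinPoly_le p s n)))]
  refine (norm_sum_le _ _).trans ((sum_le_card_nsmul _ _ (borweinMaxAbs p s n : ℝ) ?_).trans ?_)
  · intro i hi
    rw [mem_range] at hi
    rw [norm_mul, norm_pow, norm_circ, one_pow, mul_one, coeff_map, eq_intCast,
      Complex.norm_intCast, ← Int.cast_abs, Int.abs_eq_natAbs]
    exact_mod_cast natAbs_borweinCoeff_le_borweinMaxAbs (Nat.le_of_lt_succ hi)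
  · rw [card_range, nsmul_eq_mul, Nat.cast_succ]

lemma borweinMaxAbs_le {p s n : ℕ} {M : ℝ} (h : ∀ x : ℝ, circProd p (n + 1) x ^ s ≤ M) :
    (borweinMaxAbs p s n : ℝ) ≤ M := by
  obtain ⟨i, -, hi⟩ := exists_mem_eq_sup (range (borweinDeg p s n + 1)) (by simp)
    fun i => (borweinCoeff p s n i).natAbs
  rw [borweinMaxAbs, hi]
  have := ((borweinPoly p s n).map (Int.castRingHom ℂ)).norm_coeff_le_of_norm_eval_circ_le
    (fun x => (norm_eval_borweinPoly p s n x).trans_le (h x)) i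
  rw [coeff_map, eq_intCast, Complex.norm_intCast, ← Int.cast_abs] at this
  rwa [borweinCoeff, Nat.cast_natAbs]

lemma pow_le_borweinMaxAbs {p : ℕ} (hp : 0 < p) (s n : ℕ) :
    (p : ℝ) ^ (s * (n + 1)) ≤ (borweinDeg p s n + 1) * borweinMaxAbs p s n := by
  have hq : ((1 : ℚ) / p).den = p := by
    rw [one_div, Rat.inv_natCast_den_of_pos hp]
  have h := norm_eval_borweinPoly_le p s n ((1 : ℚ) / p : ℚ)
  rwa [norm_eval_borweinPoly, circProd_rat hp _ _ hq, ← pow_mul, mul_comm (n + 1)] at h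

lemma borweinDeg_add_one_le {p s n : ℕ} (hp : 0 < p) (hs : 0 < s) (hn : 2 ≤ n) :
    (borweinDeg p s n + 1 : ℝ) ≤ (4 * p ^ 2 * s) * n ^ 2 := by
  have h : borweinDeg p s n + 1 ≤ 4 * p ^ 2 * s * n ^ 2 := by
    obtain ⟨m, rfl⟩ : ∃ m, p = m + 1 := ⟨p - 1, by omega⟩
    have h1 : borweinDeg (m + 1) s n ≤ (m + 1) * m * s * (n + 1) ^ 2 := Nat.div_le_self _ _
    have h2 : 1 ≤ (m + 1) * s * (n + 1) ^ 2 := Nat.succ_le_of_lt (by positivity)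
    have h3 : n + 1 ≤ 2 * n := by omega
    calc _ ≤ (m + 1) * m * s * (n + 1) ^ 2 + (m + 1) * s * (n + 1) ^ 2 := by gcongr
      _ = (m + 1) ^ 2 * s * (n + 1) ^ 2 := by ring
      _ ≤ (m + 1) ^ 2 * s * (2 * n) ^ 2 := by gcongr
      _ = _ := by ring
  exact_mod_cast h

theorem stmt_8 (p s : ℕ) (hp : p = 2 ∨ p = 3 ∨ p = 5 ∨ p = 7 ∨ p = 11 ∨ p = 13)
    (hs : 1 ≤ s) :
    ∃ C : ℝ, 0 < C ∧ ∃ N₀ : ℕ, ∀ n : ℕ, N₀ ≤ n →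
      |Real.logb p (borweinMaxAbs p s n) - ((s : ℝ) * ((n : ℝ) + 1))| ≤ C * Real.log n := by
  have hprime : p.Prime := by rcases hp with rfl | rfl | rfl | rfl | rfl | rfl <;> norm_num
  obtain ⟨N₀, hN₀⟩ := exists_circProd_le hprime (sub_one_mul_le_log hp)
  have hp2 : (2 : ℝ) ≤ p := by exact_mod_cast hprime.two_le
  have hs1 : (1 : ℝ) ≤ s := by exact_mod_cast hs
  have hlog2 := Real.log_two_gt_d9
  have hlogp : Real.log 2 ≤ Real.log p := Real.log_le_log (by norm_num) hp2
  have hA : 0 ≤ Real.log (4 * p ^ 2 * s) := Real.log_nonneg (by nlinarith)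
  have hB : 0 ≤ s * (Real.pi * p) := by positivity
  refine ⟨(2 * (s * (Real.pi * p)) + 2 * Real.log (4 * p ^ 2 * s) + 2) / Real.log p,
    div_pos (by linarith) (by linarith), max 2 N₀, fun n hn => ?_⟩
  have hn2 : 2 ≤ n := (le_max_left _ _).trans hn
  have hn2' : (2 : ℝ) ≤ n := by exact_mod_cast hn2
  have hlogn : Real.log 2 ≤ Real.log n := Real.log_le_log (by norm_num) hn2'
  have hlow := pow_le_borweinMaxAbs hprime.pos s n
  have hM : (0 : ℝ) < borweinMaxAbs p s n := by
    have : (0 : ℝ) < (p : ℝ) ^ (s * (n + 1)) := by positivity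
    exact pos_of_mul_pos_right (this.trans_le hlow) (by positivity)
  have hup : (borweinMaxAbs p s n : ℝ) ≤ ((p : ℝ) ^ (n + 1) * Real.exp (Real.pi * p)) ^ s :=
    borweinMaxAbs_le fun x => pow_le_pow_left₀ (circProd_nonneg _ _ _)
      (hN₀ (n + 1) (((le_max_right _ _).trans hn).trans n.le_succ) x) s
  have hdeg := borweinDeg_add_one_le hprime.pos hs hn2
  have h1 : Real.log (borweinMaxAbs p s n) ≤ s * (n + 1) * Real.log p + s * (Real.pi * p) := by
    have := Real.log_le_log hM hup
    rw [Real.log_pow, Real.log_mul (by positivity) (by positivity), Real.log_exp,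
      Real.log_pow] at this
    push_cast at this
    linarith
  have h2 : s * (n + 1) * Real.log p ≤
      Real.log (4 * p ^ 2 * s) + 2 * Real.log n + Real.log (borweinMaxAbs p s n) := by
    have := Real.log_le_log (by positivity)
      (hlow.trans (mul_le_mul_of_nonneg_right hdeg hM.le))
    rw [Real.log_pow, Real.log_mul (by positivity) hM.ne',
      Real.log_mul (by positivity) (by positivity), Real.log_pow] at this
    push_cast at this
    linarith
  have hlp : 0 < Real.log p := by linarith
  rw [Real.logb, div_mul_eq_mul_div, ← mul_div_cancel_right₀ ((s : ℝ) * (n + 1)) hlp.ne', ← sub_div,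
    abs_div, abs_of_pos hlp]
  refine div_le_div_of_nonneg_right ?_ hlp.le
  rw [abs_le]
  constructor <;> nlinarith
end
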